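/- Let M ≥ 1 and p ∈ (0,1)^M, and let (Y_n)_{n≥0} be a standard excited random walk with M cookies and cookie strength vector p. Then Y_n → +∞ almost surely (i.e., the walk is transient to the right) if and only if δ(M,p) > 1. -/

import Mathlib

open MeasureTheory ProbabilityTheory Filter Topology

/-- The success probability of the `j+1`-st visit to a site: `p (j+1)` while cookies
remain (`j < M`), and the bias parameter `p₀` afterwards. -/
noncomputable def cookieSeq (M : ℕ) (p : Fin M → ℝ) (p₀ : ℝ) (j : ℕ) : ℝ :=
  if h : j < M then p ⟨j, h⟩ else p₀

/-- `IsEARW P M p p₀ X` : under the probability measure `P`, the process `X` is an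
excited asymmetric random walk with `M` cookies of strengths `p ∈ (0,1)^M` and bias
parameter `p₀`: it starts at `0`, moves by `±1` steps, and conditionally on the path
`(X 0, …, X n)` it steps right with probability `p i` on the event
`#{m ≤ n : X m = X n} = i` for `1 ≤ i ≤ M`, and with probability `p₀` on the event
`#{m ≤ n : X m = X n} > M`. -/
structure IsEARW {Ω : Type*} [MeasurableSpace Ω] (P : Measure Ω)
    (M : ℕ) (p : Fin M → ℝ) (p₀ : ℝ) (X : ℕ → Ω → ℤ) : Prop where
  measurable : ∀ n, Measurable (X n)
  init : ∀ ω, X 0 ω = 0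
  steps : ∀ ω n, |X (n + 1) ω - X n ω| = 1
  cond : ∀ (n : ℕ) (w : Fin (n + 1) → ℤ),
    P ({ω | X (n + 1) ω = w (Fin.last n) + 1} ∩ {ω | ∀ m : Fin (n + 1), X m ω = w m})
      = ENNReal.ofReal
          (cookieSeq M p p₀
            ((Finset.univ.filter fun m : Fin (n + 1) => w m = w (Fin.last n)).card - 1))
        * P {ω | ∀ m : Fin (n + 1), X m ω = w m}

namespace ExcitedWalk

/-! ### Offspring of a stack of coins -/

/-- The number of right steps among the first `t` instructions of the stack `s`. -/
def heads (s : ℕ → Bool) (t : ℕ) : ℕ := Nat.count (fun i => s i = true) t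

/-- The number of left steps among the first `t` instructions of the stack `s`. -/
def tails (s : ℕ → Bool) (t : ℕ) : ℕ := Nat.count (fun i => s i = false) t

/-- The number of right steps in the stack `s` before its `n`-th left step. -/
noncomputable def offspring (s : ℕ → Bool) (n : ℕ) : ℕ := heads s (sInf {t | n ≤ tails s t})

lemma heads_mono (s : ℕ → Bool) : Monotone (heads s) := Nat.count_monotone _

lemma tails_mono (s : ℕ → Bool) : Monotone (tails s) := Nat.count_monotone _

lemma heads_add_tails (s : ℕ → Bool) (t : ℕ) : heads s t + tails s t = t := by
  induction t with
  | zero => simp [heads, tails]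
  | succ t ih =>
    simp only [heads, tails, Nat.count_succ] at ih ⊢
    cases s t <;> simp <;> omega

lemma exists_le_count {p : ℕ → Prop} [DecidablePred p] (h : ∃ᶠ i in atTop, p i) (n : ℕ) :
    ∃ t, n ≤ Nat.count p t :=
  ⟨Nat.nth p n, (Nat.count_nth_of_infinite (Nat.frequently_atTop_iff_infinite.1 h) n).ge⟩

lemma offspring_le_heads {s : ℕ → Bool} {n t : ℕ} (h : n ≤ tails s t) :
    offspring s n ≤ heads s t :=
  heads_mono s (Nat.sInf_le h)

lemma heads_le_offspring {s : ℕ → Bool} (hs : ∃ᶠ i in atTop, s i = false) {n t : ℕ}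
    (h : tails s t < n) : heads s t ≤ offspring s n := by
  refine heads_mono s (not_lt.1 fun hlt => ?_)
  have hmem : n ≤ tails s (sInf {t | n ≤ tails s t}) :=
    Nat.sInf_mem (s := {t | n ≤ tails s t}) (exists_le_count hs n)
  have := tails_mono s hlt.le
  omega

@[simp] lemma offspring_zero (s : ℕ → Bool) : offspring s 0 = 0 := by
  simp [offspring, heads]

lemma offspring_eq_heads {s : ℕ → Bool} {n t : ℕ} (h : tails s (t + 1) = n + 1)
    (ht : s t = false) : offspring s (n + 1) = heads s t := by
  have e : heads s (t + 1) = heads s t := by simp [heads, Nat.count_succ, ht]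
  have e' : tails s (t + 1) = tails s t + 1 := by simp [tails, Nat.count_succ, ht]
  have : sInf {t | n + 1 ≤ tails s t} = t + 1 := by
    refine le_antisymm (Nat.sInf_le h.ge) (le_csInf ⟨t + 1, h.ge⟩ fun u hu => ?_)
    by_contra! hlt
    have := tails_mono s (Nat.le_of_lt_succ hlt)
    simp only [Set.mem_ofPred_eq] at hu
    omega
  rw [offspring, this, e]

/-- Discarding the first `j` instructions of a stack. -/
def drop (s : ℕ → Bool) (j : ℕ) : ℕ → Bool := fun i => s (j + i)

lemma offspring_succ {s : ℕ → Bool} (hs : ∃ᶠ i in atTop, s i = false) (n : ℕ) :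
    offspring s (n + 1) = if s 0 then offspring (drop s 1) (n + 1) + 1
      else offspring (drop s 1) n := by
  have hh : ∀ t, heads s (t + 1) = heads (drop s 1) t + if s 0 then 1 else 0 := fun t => by
    simp only [heads, Nat.count_succ', drop, Nat.add_comm 1]
  have ht : ∀ t, tails s (t + 1) = tails (drop s 1) t + if s 0 then 0 else 1 := fun t => by
    simp only [tails, Nat.count_succ', drop, Nat.add_comm 1]
    cases s 0 <;> simp
  have key : sInf {t | n + 1 ≤ tails s t}
      = sInf {t | (if s 0 then n + 1 else n) ≤ tails (drop s 1) t} + 1 := by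
    have h0 : ∀ t, n + 1 ≤ tails s (t + 1) ↔ (if s 0 then n + 1 else n) ≤ tails (drop s 1) t := by
      intro t; rw [ht]; cases s 0 <;> simp
    obtain ⟨t, ht'⟩ := exists_le_count hs (n + 1)
    have hmem : n + 1 ≤ tails s (sInf {t | n + 1 ≤ tails s t}) :=
      Nat.sInf_mem (s := {t | n + 1 ≤ tails s t}) ⟨t, ht'⟩
    rcases hu : sInf {t | n + 1 ≤ tails s t} with _ | u
    · rw [hu] at hmem; simp [tails] at hmem
    · rw [hu] at hmem
      congr 1
      refine le_antisymm (le_csInf ⟨u, (h0 u).1 hmem⟩ fun v hv => ?_) (Nat.sInf_le ((h0 u).1 hmem))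
      have := Nat.sInf_le (s := {t | n + 1 ≤ tails s t}) ((h0 v).2 hv)
      omega
  rw [offspring, key, hh]
  cases s 0 <;> simp [offspring]

/-! ### The walk driven by stacks of coins -/

/-- Position and local times after `n` steps of the walk started at `0` whose `j`-th departure
from `x` is to the right iff `σ x j = true`. -/
def state (σ : ℤ → ℕ → Bool) : ℕ → ℤ × (ℤ → ℕ)
  | 0 => (0, 0)
  | n + 1 =>
    let z := state σ n
    (if σ z.1 (z.2 z.1) then z.1 + 1 else z.1 - 1, Function.update z.2 z.1 (z.2 z.1 + 1))

/-- The walk driven by the stacks `σ`. -/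
def walk (σ : ℤ → ℕ → Bool) (n : ℕ) : ℤ := (state σ n).1

/-- The number of departures from `x` before time `n`. -/
def visits (σ : ℤ → ℕ → Bool) (n : ℕ) (x : ℤ) : ℕ := (state σ n).2 x

variable (σ : ℤ → ℕ → Bool)

@[simp] lemma walk_zero : walk σ 0 = 0 := rfl

@[simp] lemma visits_zero (x : ℤ) : visits σ 0 x = 0 := rfl

lemma walk_succ (n : ℕ) : walk σ (n + 1)
    = if σ (walk σ n) (visits σ n (walk σ n)) then walk σ n + 1 else walk σ n - 1 := rfl

lemma visits_succ (n : ℕ) (x : ℤ) :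
    visits σ (n + 1) x = visits σ n x + if x = walk σ n then 1 else 0 := by
  simp only [visits, state, walk, Function.update_apply]
  split_ifs with h <;> simp [h]

lemma visits_mono (x : ℤ) : Monotone fun n => visits σ n x :=
  monotone_nat_of_le_succ fun n => by simp [visits_succ]

lemma visits_eq_count (n : ℕ) (x : ℤ) :
    visits σ n x = Nat.count (fun m => walk σ m = x) n := by
  induction n with
  | zero => simp
  | succ n ih => rw [visits_succ, ih, Nat.count_succ]; simp [eq_comm]

lemma abs_walk_le (n : ℕ) : |walk σ n| ≤ n := by
  induction n with
  | zero => simp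
  | succ n ih =>
    rw [walk_succ, abs_le] at *
    push_cast
    split_ifs <;> constructor <;> linarith [ih.1, ih.2]

lemma visits_eq_zero_of_forall_ne {n : ℕ} {x : ℤ} (h : ∀ m < n, walk σ m ≠ x) :
    visits σ n x = 0 := by
  rwa [visits_eq_count, Nat.count_iff_forall_not]

lemma visits_le (n : ℕ) (x : ℤ) : visits σ n x ≤ n := by
  rw [visits_eq_count]; exact Nat.count_le _

lemma visits_eq_zero {n : ℕ} {x : ℤ} (h : n ≤ x) : visits σ n x = 0 := by
  refine visits_eq_zero_of_forall_ne σ fun m hm e => ?_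
  have := (abs_le.1 (abs_walk_le σ m)).2
  omega

/-- Conservation of the flow through the edge `{x, x + 1}`. -/
lemma heads_sub_tails (n : ℕ) (x : ℤ) :
    (heads (σ x) (visits σ n x) : ℤ) - tails (σ (x + 1)) (visits σ n (x + 1))
      = (if x < walk σ n then 1 else 0) - if x < 0 then 1 else 0 := by
  induction n with
  | zero =>
    simp only [visits_zero, walk_zero, heads, tails, Nat.count_zero]
    by_cases hx : x < 0 <;> simp [hx]
  | succ n ih =>
    have h1 : (heads (σ x) (visits σ (n + 1) x) : ℤ) = heads (σ x) (visits σ n x)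
        + if x = walk σ n ∧ σ x (visits σ n x) = true then 1 else 0 := by
      rw [visits_succ]
      by_cases h : x = walk σ n <;> simp [heads, Nat.count_succ, h]
    have h2 : (tails (σ (x + 1)) (visits σ (n + 1) (x + 1)) : ℤ)
        = tails (σ (x + 1)) (visits σ n (x + 1))
        + if x + 1 = walk σ n ∧ σ (x + 1) (visits σ n (x + 1)) = false then 1 else 0 := by
      rw [visits_succ]
      by_cases h : x + 1 = walk σ n <;> simp [tails, Nat.count_succ, h]
    have h3 : (if x < walk σ (n + 1) then (1 : ℤ) else 0) = (if x < walk σ n then 1 else 0)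
        + (if x = walk σ n ∧ σ x (visits σ n x) = true then 1 else 0)
        - if x + 1 = walk σ n ∧ σ (x + 1) (visits σ n (x + 1)) = false then 1 else 0 := by
      rw [walk_succ]
      by_cases e1 : x = walk σ n
      · subst e1
        rcases Bool.eq_false_or_eq_true (σ (walk σ n) (visits σ n (walk σ n))) with h | h <;>
          simp [h]
      by_cases e2 : x + 1 = walk σ n
      · rw [e2]
        rcases Bool.eq_false_or_eq_true (σ (walk σ n) (visits σ n (walk σ n))) with h | h <;>
          simp [h, e1] <;> (repeat' split_ifs) <;> omega
      simp only [e1, e2, false_and, if_false]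
      repeat' split_ifs
      all_goals omega
    rw [h1, h2, h3]
    linarith

/-- The branching chain started from `n` individuals: the individuals of each generation
reproduce through the stacks at `k`, `k + 1`, and so on. -/
noncomputable def chain (σ : ℤ → ℕ → Bool) : ℤ → ℕ → ℕ → ℕ
  | _, n, 0 => n
  | k, n, K + 1 => chain σ (k + 1) (offspring (σ k) n) K

lemma chain_succ (k : ℤ) (n K : ℕ) :
    chain σ k n (K + 1) = offspring (σ (k + K)) (chain σ k n K) := by
  induction K generalizing k n with
  | zero => simp [chain]
  | succ K ih =>
    rw [chain, ih, chain]
    push_cast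
    ring_nf

lemma chain_antitone (k : ℤ) (n : ℕ) : Antitone fun K => {σ | chain σ k n K ≠ 0} :=
  antitone_nat_of_succ_le fun K σ h h' => h (by rw [chain_succ, h', offspring_zero])

variable {σ}

lemma exists_chain_ne_zero_of_tendsto_atTop (hσ : ∀ x, ∃ᶠ i in atTop, σ x i = false)
    (h : Tendsto (walk σ) atTop atTop) : ∃ n, ∀ K, chain σ 1 n K ≠ 0 := by
  obtain ⟨N, hN⟩ := (h.eventually_gt_atTop 0).exists_forall_of_atTop
  have hb : ∀ n, visits σ n 0 ≤ N := by
    intro n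
    rcases le_total n N with hn | hn
    · exact (visits_le σ n 0).trans hn
    · have : ∀ m, visits σ (N + m) 0 ≤ N := by
        intro m
        induction m with
        | zero => exact visits_le σ N 0
        | succ m ih =>
          have := hN (N + m) (by omega)
          rw [← Nat.add_assoc, visits_succ, if_neg (by omega)]
          exact ih
      obtain ⟨m, rfl⟩ := Nat.exists_eq_add_of_le hn
      exact this m
  refine ⟨N, fun K => ?_⟩
  obtain ⟨t, ht⟩ := (h.eventually_gt_atTop (K : ℤ)).exists
  have key : ∀ j ≤ K, heads (σ j) (visits σ t j) ≤ chain σ 1 N j := by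
    intro j
    induction j with
    | zero =>
      intro _
      have := heads_add_tails (σ 0) (visits σ t 0)
      have := hb t
      simp only [Nat.cast_zero, chain]
      omega
    | succ j ih =>
      intro hj
      have hf := heads_sub_tails σ t j
      rw [if_pos (by omega), if_neg (by omega)] at hf
      rw [chain_succ]
      push_cast
      rw [add_comm (1 : ℤ)]
      exact heads_le_offspring (hσ _) (by have := ih (by omega); omega)
  have hf := heads_sub_tails σ t K
  rw [if_pos (by omega), if_neg (by omega)] at hf
  have := key K le_rfl
  omega

lemma le_walk_of_chain_ne_zero {k : ℤ} (hk : 1 ≤ k) (hc : ∀ K, chain σ k 1 K ≠ 0) {m n : ℕ}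
    (hm : k ≤ walk σ m) (hmn : m ≤ n) : k ≤ walk σ n := by
  by_contra! hn
  have hpos : 1 ≤ heads (σ (k - 1)) (visits σ n (k - 1)) := by
    have hf := heads_sub_tails σ m (k - 1)
    rw [if_pos (by omega), if_neg (by omega)] at hf
    have := heads_mono (σ (k - 1)) (visits_mono σ (k - 1) hmn)
    simp only at this
    omega
  have key : ∀ j : ℕ, chain σ k 1 j ≤ heads (σ (k - 1 + j)) (visits σ n (k - 1 + j)) := by
    intro j
    induction j with
    | zero => simpa [chain] using hpos
    | succ j ih =>
      have hf := heads_sub_tails σ n (k - 1 + j)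
      rw [if_neg (by omega), if_neg (by omega)] at hf
      rw [chain_succ]
      have e : k - 1 + ((j + 1 : ℕ) : ℤ) = k + j := by push_cast; ring
      have e' : k - 1 + (j : ℤ) + 1 = k + j := by ring
      rw [e]
      rw [e'] at hf
      exact offspring_le_heads (by omega)
  have := key n
  rw [visits_eq_zero σ (by omega)] at this
  exact hc n (by simpa [heads] using this)

lemma exists_le_walk (hσ : ∀ x, ∃ᶠ i in atTop, σ x i = true)
    (h : ¬ Tendsto (walk σ) atTop atBot) (k : ℤ) : ∃ n, k ≤ walk σ n := by
  by_contra! hk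
  obtain ⟨x, hx⟩ : ∃ x, ∃ᶠ n in atTop, walk σ n = x := by
    by_contra! hx
    refine h (tendsto_atBot.2 fun b => ?_)
    have : ∀ᶠ n in atTop, ∀ x ∈ Finset.Icc b k, walk σ n ≠ x :=
      (Filter.eventually_all_finset _).2 fun x _ => hx x
    filter_upwards [this] with n hn
    by_contra! hb
    exact hn _ (Finset.mem_Icc.2 ⟨hb.le, (hk n).le⟩) rfl
  have key : ∀ j : ℕ, ∀ N, ∃ n, N ≤ visits σ n (x + j) := by
    intro j
    induction j with
    | zero =>
      intro N
      simp only [visits_eq_count, Nat.cast_zero, add_zero]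
      exact exists_le_count hx N
    | succ j ih =>
      intro N
      obtain ⟨t, ht⟩ := exists_le_count (hσ (x + j)) (N + 1)
      obtain ⟨n, hn⟩ := ih t
      have h1 : N + 1 ≤ heads (σ (x + j)) (visits σ n (x + j)) := ht.trans (heads_mono _ hn)
      have hf := heads_sub_tails σ n (x + j)
      have h2 := heads_add_tails (σ (x + j + 1)) (visits σ n (x + j + 1))
      refine ⟨n, ?_⟩
      push_cast
      rw [← add_assoc]
      split_ifs at hf <;> omega
  obtain ⟨n0, hn0⟩ := hx.exists
  have hxk := hk n0
  obtain ⟨n, hn⟩ := key (k - x).toNat 1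
  rw [show x + ((k - x).toNat : ℤ) = k by omega] at hn
  have : visits σ n k = 0 := by
    refine visits_eq_zero_of_forall_ne σ fun m _ e => ?_
    have := hk m
    omega
  omega

lemma tendsto_atTop_of_frequently_chain (hσ : ∀ x, ∃ᶠ i in atTop, σ x i = true)
    (h : ¬ Tendsto (walk σ) atTop atBot)
    (hc : ∃ᶠ k : ℕ in atTop, ∀ K, chain σ k 1 K ≠ 0) : Tendsto (walk σ) atTop atTop := by
  refine tendsto_atTop.2 fun b => ?_
  obtain ⟨k, hk, hck⟩ := frequently_atTop.1 hc (b.toNat + 1)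
  obtain ⟨m, hm⟩ := exists_le_walk hσ h k
  filter_upwards [eventually_ge_atTop m] with n hn
  have := le_walk_of_chain_ne_zero (by omega) hck hm hn
  omega

/-! ### Random stacks -/

section Independence

variable {Ω α β : Type*} [MeasurableSpace Ω] {P : Measure Ω}
  [MeasurableSpace α] [MeasurableSpace β]

/-- Integrating over two independent variables successively. -/
lemma integral_comp_indepFun [IsProbabilityMeasure P] {A : Ω → α} {B : Ω → β}
    (hA : Measurable A) (hB : Measurable B)
    (h : IndepFun A B P) {F : α × β → ℝ} (hF : Measurable F) {C : ℝ} (hC : ∀ z, |F z| ≤ C) :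
    ∫ ω, F (A ω, B ω) ∂P = ∫ ω, ∫ ω', F (A ω, B ω') ∂P ∂P := by
  have := Measure.isProbabilityMeasure_map (μ := P) hA.aemeasurable
  have := Measure.isProbabilityMeasure_map (μ := P) hB.aemeasurable
  rw [← integral_map (φ := fun ω => (A ω, B ω)) (hA.prodMk hB).aemeasurable
    hF.aestronglyMeasurable,
    (indepFun_iff_map_prod_eq_prod_map_map hA.aemeasurable hB.aemeasurable).1 h,
    integral_prod _ (Integrable.of_bound hF.aestronglyMeasurable C (ae_of_all _ hC)),
    integral_map hA.aemeasurable]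
  · refine integral_congr_ae (ae_of_all _ fun ω => ?_)
    exact integral_map hB.aemeasurable
      (hF.comp (measurable_const.prodMk measurable_id)).aestronglyMeasurable
  · exact hF.stronglyMeasurable.integral_prod_right'.aestronglyMeasurable

/-- Independence of one member of an independent family from another subfamily. -/
lemma indepFun_subfamily {ι κ γ : Type*} [MeasurableSpace γ] {f : ι → Ω → γ}
    (hf : ∀ i, Measurable (f i)) (h : iIndepFun f P) (i : ι) (e : κ → ι) (he : ∀ k, e k ≠ i) :
    IndepFun (f i) (fun ω k => f (e k) ω) P := by
  have h1 := indep_iSup_of_disjoint (fun j => (hf j).comap_le) h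
    (S := {i}) (T := Set.range e) (by
      rw [Set.disjoint_singleton_left]; rintro ⟨k, hk⟩; exact he k hk)
  rw [IndepFun_iff_Indep]
  refine indep_of_indep_of_le_left (indep_of_indep_of_le_right h1 ?_) (by simp)
  rw [MeasurableSpace.pi, MeasurableSpace.comap_iSup]
  refine iSup_le fun k => ?_
  rw [MeasurableSpace.comap_comp]
  exact le_iSup₂_of_le (e k) ⟨k, rfl⟩ le_rfl

end Independence

section Product

variable {ι : Type*} {X : ι → Type*} [∀ i, MeasurableSpace (X i)] {μ : ∀ i, Measure (X i)}
  [∀ i, IsProbabilityMeasure (μ i)]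

lemma infinitePi_pi_inter {T : Finset ι} {t : ∀ i, Set (X i)} (ht : ∀ i, MeasurableSet (t i))
    {i : ι} (hi : i ∈ T) {B : Set (X i)} (hB : MeasurableSet B) {c : ENNReal}
    (hc : μ i (B ∩ t i) = c * μ i (t i)) :
    Measure.infinitePi μ ({x | x i ∈ B} ∩ Set.pi T t) = c * Measure.infinitePi μ (Set.pi T t) := by
  classical
  have e : {x | x i ∈ B} ∩ Set.pi T t = Set.pi T (Function.update t i (B ∩ t i)) := by
    ext x
    simp only [Set.mem_inter_iff, Set.mem_ofPred_eq, Set.mem_pi, Finset.mem_coe]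
    constructor
    · rintro ⟨h1, h2⟩ j hj
      by_cases hij : j = i
      · subst hij; simpa using ⟨h1, h2 _ hj⟩
      · simpa [hij] using h2 j hj
    · intro h
      have h3 := h i hi
      simp only [Function.update_self] at h3
      refine ⟨h3.1, fun j hj => ?_⟩
      by_cases hij : j = i
      · subst hij; exact h3.2
      · simpa [hij] using h j hj
  have hm : ∀ j ∈ T, MeasurableSet (Function.update t i (B ∩ t i) j) := by
    intro j _
    by_cases hij : j = i
    · subst hij; simpa using hB.inter (ht _)
    · simpa [hij] using ht j
  rw [e, Measure.infinitePi_pi _ hm, Measure.infinitePi_pi _ fun j _ => ht j,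
    ← Finset.mul_prod_erase T _ hi, ← Finset.mul_prod_erase T (fun j => μ j (t j)) hi,
    Function.update_self, hc, mul_assoc]
  congr 2
  refine Finset.prod_congr rfl fun j hj => ?_
  rw [Function.update_of_ne (Finset.ne_of_mem_erase hj)]

end Product

/-- The law of a coin showing `true` with probability `q`. -/
noncomputable abbrev coin (q : unitInterval) : Measure Bool := bernoulliMeasure true false q

lemma coin_true (q : unitInterval) : coin q {true} = ENNReal.ofReal q := by
  rw [bernoulliMeasure_apply_of_mem_of_notMem _ (measurableSet_singleton _) rfl (by simp)]
  simp [ENNReal.ofReal, Real.toNNReal_of_nonneg q.2.1, unitInterval.toNNReal]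
  rfl

lemma coin_false (q : unitInterval) : coin q {false} = ENNReal.ofReal (1 - q) := by
  rw [bernoulliMeasure_apply_of_notMem_of_mem _ (measurableSet_singleton _) (by simp) rfl]
  simp [ENNReal.ofReal, Real.toNNReal_of_nonneg (sub_nonneg.2 q.2.2), unitInterval.toNNReal,
    unitInterval.coe_symm_eq]
  rfl

lemma integral_coin (q : unitInterval) (f : Bool → ℝ) :
    ∫ b, f b ∂coin q = q * f true + (1 - q) * f false := by
  rw [integral_fintype (.of_finite)]
  simp

/-- The law of a stack of independent coins with biases `q`. -/
noncomputable def stackMeasure (q : ℕ → unitInterval) : Measure (ℕ → Bool) :=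
  Measure.infinitePi fun j => coin (q j)

/-- The law of a family, indexed by the sites, of independent stacks. -/
noncomputable def envMeasure (q : ℕ → unitInterval) : Measure (ℤ → ℕ → Bool) :=
  Measure.infinitePi fun _ => stackMeasure q

instance (q : ℕ → unitInterval) : IsProbabilityMeasure (stackMeasure q) := by
  unfold stackMeasure; infer_instance

instance (q : ℕ → unitInterval) : IsProbabilityMeasure (envMeasure q) := by
  unfold envMeasure; infer_instance

lemma measurable_heads (t : ℕ) : Measurable fun s : ℕ → Bool => heads s t := by
  induction t with
  | zero => simp [heads]
  | succ t ih =>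
    simp only [heads, Nat.count_succ] at ih ⊢
    refine ih.add (Measurable.ite ?_ measurable_const measurable_const)
    exact measurableSet_eq_fun (measurable_pi_apply t) measurable_const

lemma measurable_tails (t : ℕ) : Measurable fun s : ℕ → Bool => tails s t := by
  have : (fun s : ℕ → Bool => tails s t) = fun s => t - heads s t := by
    ext s; have := heads_add_tails s t; omega
  rw [this]
  exact measurable_const.sub (measurable_heads t)

lemma measurable_offspring (n : ℕ) : Measurable fun s : ℕ → Bool => offspring s n := by
  have h1 : Measurable fun z : (ℕ → Bool) × ℕ => heads z.1 z.2 :=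
    measurable_from_prod_countable_left measurable_heads
  refine h1.comp (measurable_id.prodMk (measurable_of_Iic fun t => ?_))
  have e : (fun s : ℕ → Bool => sInf {t | n ≤ tails s t}) ⁻¹' Set.Iic t
      = {s | n ≤ tails s t} ∪ ⋂ u, {s | tails s u < n} := by
    ext s
    simp only [Set.mem_preimage, Set.mem_Iic, Set.mem_union, Set.mem_ofPred_eq, Set.mem_iInter]
    constructor
    · intro h
      by_contra! hc
      obtain ⟨hc1, u, hu⟩ := hc
      have hmem : n ≤ tails s (sInf {t | n ≤ tails s t}) :=
        Nat.sInf_mem (s := {t | n ≤ tails s t}) ⟨u, hu⟩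
      have := tails_mono s h
      omega
    · rintro (h | h)
      · exact Nat.sInf_le h
      · have : {t | n ≤ tails s t} = ∅ := by
          ext u; simpa using h u
        simp [this]
  rw [e]
  exact (measurableSet_le measurable_const (measurable_tails t)).union
    (MeasurableSet.iInter fun u => measurableSet_lt (measurable_tails u) measurable_const)

lemma measurable_drop (j : ℕ) : Measurable fun s : ℕ → Bool => drop s j :=
  measurable_pi_lambda _ fun _ => measurable_pi_apply _

lemma measurable_chain (k : ℤ) (n K : ℕ) :
    Measurable fun σ : ℤ → ℕ → Bool => chain σ k n K := by
  induction K with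
  | zero => exact measurable_const
  | succ K ih =>
    simp only [chain_succ]
    have h1 : Measurable fun z : (ℕ → Bool) × ℕ => offspring z.1 z.2 :=
      measurable_from_prod_countable_left measurable_offspring
    exact h1.comp ((measurable_pi_apply _).prodMk ih)

variable {q : ℕ → unitInterval}

lemma iIndepFun_stack : iIndepFun (fun j (s : ℕ → Bool) => s j) (stackMeasure q) :=
  iIndepFun_infinitePi (X := fun _ b => b) fun _ => measurable_id

lemma iIndepFun_env : iIndepFun (fun x (σ : ℤ → ℕ → Bool) => σ x) (envMeasure q) :=
  iIndepFun_infinitePi (X := fun _ s => s) fun _ => measurable_id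

lemma measurePreserving_stack (j : ℕ) :
    MeasurePreserving (fun s : ℕ → Bool => s j) (stackMeasure q) (coin (q j)) :=
  measurePreserving_eval_infinitePi _ j

lemma measurePreserving_env (x : ℤ) :
    MeasurePreserving (fun σ : ℤ → ℕ → Bool => σ x) (envMeasure q) (stackMeasure q) :=
  measurePreserving_eval_infinitePi (fun _ => stackMeasure q) x

lemma ae_frequently_stack (b : Bool) {c : ENNReal} (hc : c ≠ 0)
    (h : ∀ᶠ j in atTop, c ≤ coin (q j) {b}) :
    ∀ᵐ s ∂stackMeasure q, ∃ᶠ i in atTop, s i = b := by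
  have hm : ∀ n, MeasurableSet {s : ℕ → Bool | s n = b} := fun n =>
    measurableSet_eq_fun (measurable_pi_apply n) measurable_const
  have hi : iIndepSet (fun n => {s : ℕ → Bool | s n = b}) (stackMeasure q) := by
    rw [iIndepSet_iff_meas_biInter hm]
    intro S
    exact iIndepFun_stack.meas_biInter fun i _ => ⟨{b}, measurableSet_singleton _, rfl⟩
  have hs : ∑' n, stackMeasure q {s : ℕ → Bool | s n = b} = ⊤ := by
    obtain ⟨N, hN⟩ := h.exists_forall_of_atTop
    refine top_unique ?_
    calc ⊤ = ∑' _ : ℕ, c := (ENNReal.tsum_const_eq_top_of_ne_zero hc).symm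
      _ ≤ ∑' n, stackMeasure q {s : ℕ → Bool | s (n + N) = b} := by
        refine ENNReal.tsum_le_tsum fun n => ?_
        have := (measurePreserving_stack (q := q) (n + N)).measure_preimage
          (measurableSet_singleton b).nullMeasurableSet
        exact (hN _ (by omega)).trans this.ge
      _ ≤ _ := ENNReal.tsum_comp_le_tsum_of_injective (add_left_injective N)
        (fun n => stackMeasure q {s : ℕ → Bool | s n = b})
  have := measure_limsup_eq_one hm hi hs
  rw [← prob_compl_eq_zero_iff (MeasurableSet.measurableSet_limsup hm)] at this
  filter_upwards [compl_mem_ae_iff.2 this] with s hs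
  rw [compl_compl] at hs
  exact (mem_limsup_iff_frequently_mem (s := fun n => {s : ℕ → Bool | s n = b})).1 hs

/-! ### Laws of excited random walks -/

section Law

variable {Ω Ω' : Type*} [MeasurableSpace Ω] [MeasurableSpace Ω'] {P : Measure Ω} {P' : Measure Ω'}
  {M : ℕ} {p : Fin M → ℝ} {p₀ : ℝ} {X : ℕ → Ω → ℤ} {X' : ℕ → Ω' → ℤ}

lemma measurableSet_path (hX : IsEARW P M p p₀ X) (n : ℕ) (w : Fin n → ℤ) :
    MeasurableSet {ω | ∀ m : Fin n, X m ω = w m} := by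
  have : {ω | ∀ m : Fin n, X m ω = w m} = ⋂ m : Fin n, {ω | X m ω = w m} := by ext; simp
  rw [this]
  exact MeasurableSet.iInter fun m => measurableSet_eq_fun (hX.measurable _) measurable_const

/-- Splitting a path event according to its last step. -/
lemma measure_path_step_left [IsFiniteMeasure P] (hX : IsEARW P M p p₀ X) (n : ℕ)
    (w : Fin (n + 1) → ℤ) :
    P ({ω | X (n + 1) ω = w (Fin.last n) - 1} ∩ {ω | ∀ m : Fin (n + 1), X m ω = w m})
      = P {ω | ∀ m : Fin (n + 1), X m ω = w m}
        - P ({ω | X (n + 1) ω = w (Fin.last n) + 1} ∩ {ω | ∀ m : Fin (n + 1), X m ω = w m}) := by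
  have hm : MeasurableSet
      ({ω | X (n + 1) ω = w (Fin.last n) + 1} ∩ {ω | ∀ m : Fin (n + 1), X m ω = w m}) :=
    (measurableSet_eq_fun (hX.measurable _) measurable_const).inter (measurableSet_path hX _ w)
  rw [← measure_sdiff Set.inter_subset_right hm.nullMeasurableSet (measure_ne_top _ _)]
  congr 1
  ext ω
  simp only [Set.mem_inter_iff, Set.mem_ofPred_eq, Set.mem_sdiff, not_and]
  have h1 := hX.steps ω n
  constructor
  · rintro ⟨h, h'⟩
    exact ⟨h', fun h2 => by omega⟩
  · rintro ⟨h', h⟩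
    have h2 := h' (Fin.last n)
    simp only [Fin.val_last] at h2
    refine ⟨?_, h'⟩
    rcases abs_cases (X (n + 1) ω - X n ω) with h3 | h3
    · exact absurd h' (h (by omega))
    · omega

lemma setOf_path_succ {Ω : Type*} (X : ℕ → Ω → ℤ) (n : ℕ) (w : Fin (n + 2) → ℤ) :
    {ω | ∀ m : Fin (n + 2), X m ω = w m} = {ω | X (n + 1) ω = w (Fin.last _)}
      ∩ {ω | ∀ m : Fin (n + 1), X m ω = w m.castSucc} := by
  ext ω
  simp [Fin.forall_fin_succ', and_comm]

lemma setOf_path_succ_eq_empty {Ω : Type*} {X : ℕ → Ω → ℤ}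
    (hs : ∀ ω n, |X (n + 1) ω - X n ω| = 1) {n : ℕ} {w : Fin (n + 2) → ℤ}
    (h₁ : w (Fin.last _) ≠ w (Fin.last n).castSucc + 1)
    (h₂ : w (Fin.last _) ≠ w (Fin.last n).castSucc - 1) :
    {ω | X (n + 1) ω = w (Fin.last _)}
      ∩ {ω | ∀ m : Fin (n + 1), X m ω = w m.castSucc} = ∅ := by
  ext ω
  simp only [Set.mem_inter_iff, Set.mem_ofPred_eq, Set.mem_empty_iff_false, iff_false, not_and]
  intro h h'
  have h3 := h' (Fin.last n)
  simp only [Fin.val_last] at h3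
  have := hs ω n
  rw [abs_eq one_pos.le] at this
  omega

lemma measure_path_eq [IsProbabilityMeasure P] [IsProbabilityMeasure P']
    (hX : IsEARW P M p p₀ X) (hX' : IsEARW P' M p p₀ X') (n : ℕ) (w : Fin (n + 1) → ℤ) :
    P {ω | ∀ m : Fin (n + 1), X m ω = w m} = P' {ω | ∀ m : Fin (n + 1), X' m ω = w m} := by
  induction n with
  | zero =>
    by_cases h : 0 = w 0 <;> simp [Fin.forall_fin_one, hX.init, hX'.init, h]
  | succ n ih =>
    have hr : P ({ω | X (n + 1) ω = w (Fin.last n).castSucc + 1}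
          ∩ {ω | ∀ m : Fin (n + 1), X m ω = w m.castSucc})
        = P' ({ω | X' (n + 1) ω = w (Fin.last n).castSucc + 1}
          ∩ {ω | ∀ m : Fin (n + 1), X' m ω = w m.castSucc}) := by
      rw [hX.cond n fun m => w m.castSucc, hX'.cond n fun m => w m.castSucc, ih]
    rw [setOf_path_succ, setOf_path_succ]
    by_cases h1 : w (Fin.last _) = w (Fin.last n).castSucc + 1
    · rw [h1, hr]
    by_cases h2 : w (Fin.last _) = w (Fin.last n).castSucc - 1
    · rw [h2, measure_path_step_left hX n fun m => w m.castSucc,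
        measure_path_step_left hX' n fun m => w m.castSucc, hr, ih]
    rw [setOf_path_succ_eq_empty hX.steps h1 h2, setOf_path_succ_eq_empty hX'.steps h1 h2]
    simp

/-- The law of an excited random walk is determined by its parameters. -/
lemma map_path_eq [IsProbabilityMeasure P] [IsProbabilityMeasure P']
    (hX : IsEARW P M p p₀ X) (hX' : IsEARW P' M p p₀ X') :
    P.map (fun ω n => X n ω) = P'.map fun ω n => X' n ω := by
  have hm : Measurable fun ω n => X n ω := measurable_pi_lambda _ hX.measurable
  have hm' : Measurable fun ω n => X' n ω := measurable_pi_lambda _ hX'.measurable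
  have := Measure.isProbabilityMeasure_map (μ := P') hm'.aemeasurable
  refine IsProjectiveLimit.unique
    (P := fun I => (P'.map fun ω n => X' n ω).map I.restrict) (fun I => ?_) fun I => rfl
  obtain ⟨N, hN⟩ : ∃ N, ∀ i ∈ I, i < N + 1 :=
    ⟨I.sup id, fun i hi => Nat.lt_succ_of_le (Finset.le_sup (f := id) hi)⟩
  let g : (Fin (N + 1) → ℤ) → I → ℤ := fun w i => w ⟨i, hN i i.2⟩
  have hg : Measurable g := measurable_pi_lambda _ fun i => measurable_pi_apply _
  have hf : Measurable fun ω (m : Fin (N + 1)) => X m ω :=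
    measurable_pi_lambda _ fun m => hX.measurable m
  have hf' : Measurable fun ω (m : Fin (N + 1)) => X' m ω :=
    measurable_pi_lambda _ fun m => hX'.measurable m
  have key : P.map (fun ω (m : Fin (N + 1)) => X m ω) =
      P'.map fun ω (m : Fin (N + 1)) => X' m ω := by
    refine Measure.ext_of_singleton fun w => ?_
    rw [Measure.map_apply hf (measurableSet_singleton _),
      Measure.map_apply hf' (measurableSet_singleton _)]
    convert measure_path_eq hX hX' N w using 2 <;> ext ω <;> simp [funext_iff]
  have := congrArg (Measure.map g) key
  rw [Measure.map_map hg hf, Measure.map_map hg hf'] at this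
  beta_reduce
  rw [Measure.map_map (Finset.measurable_restrict I) hm,
    Measure.map_map (Finset.measurable_restrict I) hm']
  exact this

lemma measurableSet_tendsto_atTop : MeasurableSet {x : ℕ → ℤ | Tendsto x atTop atTop} :=
  measurableSet_tendsto _ fun n => measurable_pi_apply n

lemma cookieSeq_mem_Ioo (hp : ∀ i, p i ∈ Set.Ioo (0 : ℝ) 1) (hp₀ : p₀ ∈ Set.Ioo (0 : ℝ) 1)
    (j : ℕ) : cookieSeq M p p₀ j ∈ Set.Ioo (0 : ℝ) 1 := by
  unfold cookieSeq
  split_ifs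
  exacts [hp _, hp₀]

/-- The reflection of an excited random walk is an excited random walk. -/
lemma isEARW_neg [IsProbabilityMeasure P] (hp : ∀ i, p i ∈ Set.Ioo (0 : ℝ) 1)
    (hp₀ : p₀ ∈ Set.Ioo (0 : ℝ) 1) (hX : IsEARW P M p p₀ X) :
    IsEARW P M (fun i => 1 - p i) (1 - p₀) fun n ω => -X n ω where
  measurable n := (hX.measurable n).neg
  init ω := by simp [hX.init]
  steps ω n := by rw [← hX.steps ω n, ← abs_neg]; congr 1; ring
  cond n w := by
    have e : {ω | ∀ m : Fin (n + 1), -X m ω = w m} = {ω | ∀ m : Fin (n + 1), X m ω = -w m} := by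
      ext ω; simp [neg_eq_iff_eq_neg]
    have e' : {ω | -X (n + 1) ω = w (Fin.last n) + 1}
        = {ω | X (n + 1) ω = -w (Fin.last n) - 1} := by
      ext ω
      simp only [Set.mem_ofPred_eq]
      omega
    have hc : ∀ j, cookieSeq M (fun i => 1 - p i) (1 - p₀) j = 1 - cookieSeq M p p₀ j := by
      intro j; unfold cookieSeq; split_ifs <;> rfl
    rw [e, e', measure_path_step_left hX n fun m => -w m, hX.cond n fun m => -w m, hc]
    simp only [neg_inj]
    have h01 := cookieSeq_mem_Ioo hp hp₀
      ((Finset.univ.filter fun m : Fin (n + 1) => w m = w (Fin.last n)).card - 1)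
    rw [ENNReal.ofReal_sub _ h01.1.le, ENNReal.sub_mul fun _ _ => measure_ne_top _ _]
    simp

end Law

lemma forall_walk_eq_iff (σ σ₀ : ℤ → ℕ → Bool) (n : ℕ) :
    (∀ m ≤ n, walk σ m = walk σ₀ m) ↔ ∀ x, ∀ j < visits σ₀ n x, σ x j = σ₀ x j := by
  induction n with
  | zero => simp
  | succ n ih =>
    have hv : (∀ m ≤ n, walk σ m = walk σ₀ m) → ∀ x, visits σ n x = visits σ₀ n x := by
      intro h x
      rw [visits_eq_count, visits_eq_count, Nat.count_eq_card_filter_range,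
        Nat.count_eq_card_filter_range]
      congr 1
      refine Finset.filter_congr fun m hm => ?_
      rw [h m (Finset.mem_range.1 hm).le]
    have h1 : (∀ m ≤ n + 1, walk σ m = walk σ₀ m)
        ↔ (∀ m ≤ n, walk σ m = walk σ₀ m) ∧ walk σ (n + 1) = walk σ₀ (n + 1) := by
      simp [Nat.le_succ_iff, or_imp, forall_and]
    have h2 : (∀ x, ∀ j < visits σ₀ (n + 1) x, σ x j = σ₀ x j)
        ↔ (∀ x, ∀ j < visits σ₀ n x, σ x j = σ₀ x j) ∧
          σ (walk σ₀ n) (visits σ₀ n (walk σ₀ n)) = σ₀ (walk σ₀ n) (visits σ₀ n (walk σ₀ n)) := by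
      constructor
      · refine fun h => ⟨fun x j hj => h x j (hj.trans_le (visits_mono σ₀ x n.le_succ)), h _ _ ?_⟩
        simp [visits_succ]
      · rintro ⟨h, h'⟩ x j hj
        rw [visits_succ] at hj
        split_ifs at hj with hx
        · subst hx
          rcases Nat.lt_succ_iff_lt_or_eq.1 hj with hj | rfl
          exacts [h _ _ hj, h']
        · exact h _ _ hj
    rw [h1, h2, ← ih, and_congr_right_iff]
    intro h
    rw [walk_succ, walk_succ, hv h, h n le_rfl]
    cases σ (walk σ₀ n) (visits σ₀ n (walk σ₀ n)) <;>
      cases σ₀ (walk σ₀ n) (visits σ₀ n (walk σ₀ n)) <;> simp <;> omega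

lemma measurable_walk (n : ℕ) : Measurable fun σ : ℤ → ℕ → Bool => walk σ n := by
  have h2 : Measurable fun z : ((ℤ → ℕ → Bool) × ℤ) × ℕ => z.1.1 z.1.2 z.2 :=
    measurable_from_prod_countable_left fun j => by
      refine measurable_from_prod_countable_left fun x => ?_
      exact (measurable_pi_apply j).comp (measurable_pi_apply x)
  have key : (Measurable fun σ : ℤ → ℕ → Bool => walk σ n)
      ∧ ∀ x, Measurable fun σ : ℤ → ℕ → Bool => visits σ n x := by
    induction n with
    | zero => exact ⟨measurable_const, fun _ => measurable_const⟩
    | succ n ih =>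
      obtain ⟨ih1, ih2⟩ := ih
      have h3 : Measurable fun σ : ℤ → ℕ → Bool => visits σ n (walk σ n) := by
        have : Measurable fun z : (ℤ → ℕ → Bool) × ℤ => visits z.1 n z.2 :=
          measurable_from_prod_countable_left ih2
        exact this.comp (measurable_id.prodMk ih1)
      constructor
      · simp only [walk_succ]
        refine Measurable.ite ?_ (ih1.add_const _) (ih1.sub_const _)
        exact measurableSet_eq_fun (h2.comp ((measurable_id.prodMk ih1).prodMk h3)) measurable_const
      · intro x
        simp only [visits_succ]
        exact (ih2 x).add
          (Measurable.ite (measurableSet_eq_fun measurable_const ih1) measurable_const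
            measurable_const)
  exact key.1

/-- The walk driven by independent stacks of coins is an excited random walk. -/
lemma isEARW_walk {M : ℕ} {p : Fin M → ℝ} {p₀ : ℝ}
    (hq : ∀ j, (q j : ℝ) = cookieSeq M p p₀ j) :
    IsEARW (envMeasure q) M p p₀ fun n σ => walk σ n where
  measurable := measurable_walk
  init _ := rfl
  steps σ n := by rw [walk_succ]; split_ifs <;> simp
  cond n w := by
    rcases Set.eq_empty_or_nonempty {σ | ∀ m : Fin (n + 1), walk σ m = w m} with h | ⟨σ₀, h₀⟩
    · simp [h]
    have hw : ∀ m : Fin (n + 1), w m = walk σ₀ m := fun m => (h₀ m).symm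
    have hcard : (Finset.univ.filter fun m : Fin (n + 1) => w m = w (Fin.last n)).card - 1
        = visits σ₀ n (walk σ₀ n) := by
      simp only [hw, Finset.card_filter, Fin.val_last]
      rw [Fin.sum_univ_eq_sum_range fun m => if walk σ₀ m = walk σ₀ n then 1 else 0,
        ← Finset.card_filter, ← Nat.count_eq_card_filter_range, Nat.count_succ, ← visits_eq_count]
      simp
    set x₀ := walk σ₀ n with hx₀
    set j₀ := visits σ₀ n x₀ with hj₀
    let t : ℤ → ℕ → Set Bool := fun x j => if j < visits σ₀ n x then {σ₀ x j} else Set.univ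
    let A : ℤ → Set (ℕ → Bool) := fun x => Set.pi (Finset.range (visits σ₀ n x + 1)) (t x)
    let S : Finset ℤ := insert x₀ ((Finset.range n).image (walk σ₀))
    have ht : ∀ x j, MeasurableSet (t x j) := fun _ _ => MeasurableSet.of_discrete
    have hA : ∀ x, MeasurableSet (A x) := fun x =>
      MeasurableSet.pi (Finset.countable_toSet _) fun j _ => ht x j
    have hAmem : ∀ x s, s ∈ A x ↔ ∀ j < visits σ₀ n x, s j = σ₀ x j := by
      intro x s
      simp only [A, t, Set.mem_pi, Finset.coe_range, Set.mem_Iio]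
      constructor
      · intro h j hj
        simpa [hj] using h j (by omega)
      · intro h j _
        split_ifs with hj
        exacts [h j hj, Set.mem_univ _]
    have hE : {σ | ∀ m : Fin (n + 1), walk σ m = w m} = Set.pi S A := by
      ext σ
      have h1 : (∀ m : Fin (n + 1), walk σ m = w m) ↔ ∀ m ≤ n, walk σ m = walk σ₀ m := by
        simp only [hw, Fin.forall_iff, Nat.lt_succ_iff]
      rw [Set.mem_ofPred_eq, h1, forall_walk_eq_iff]
      simp only [Set.mem_pi, hAmem]
      refine ⟨fun h x _ => h x, fun h x j hj => ?_⟩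
      refine h x ?_ j hj
      by_contra hx
      rw [visits_eq_zero_of_forall_ne σ₀] at hj
      · omega
      · intro m hm e
        exact hx (Finset.mem_coe.2 (Finset.mem_insert_of_mem
          (Finset.mem_image.2 ⟨m, Finset.mem_range.2 hm, e⟩)))
    have hstep : {σ | walk σ (n + 1) = w (Fin.last n) + 1}
          ∩ {σ | ∀ m : Fin (n + 1), walk σ m = w m}
        = {σ | σ x₀ ∈ {s : ℕ → Bool | s j₀ ∈ ({true} : Set Bool)}} ∩ Set.pi S A := by
      rw [← hE]
      ext σ
      simp only [Set.mem_inter_iff, Set.mem_ofPred_eq, Set.mem_singleton_iff]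
      refine and_congr_left fun h => ?_
      have h1 : ∀ m ≤ n, walk σ m = walk σ₀ m := fun m hm => by
        rw [h ⟨m, by omega⟩, hw]
      have h2 : visits σ n x₀ = j₀ := by
        rw [hj₀, visits_eq_count, visits_eq_count, Nat.count_eq_card_filter_range,
          Nat.count_eq_card_filter_range]
        congr 1
        refine Finset.filter_congr fun m hm => ?_
        rw [h1 m (Finset.mem_range.1 hm).le]
      rw [walk_succ, hw, h1 n le_rfl, Fin.val_last, ← hx₀, h2]
      cases σ x₀ j₀
      · simp; omega
      · simp
    rw [hstep, hE, hcard, ← hq]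
    refine infinitePi_pi_inter hA (Finset.mem_insert_self _ _)
      (measurable_pi_apply j₀ (measurableSet_singleton _)) ?_
    refine infinitePi_pi_inter (ht x₀) (by simp [hj₀]) (measurableSet_singleton _) ?_
    rw [show t x₀ j₀ = Set.univ by simp [t, hj₀], Set.inter_univ, coin_true, measure_univ, mul_one]

/-! ### Generating function of the offspring -/

section Step

variable {M : ℕ}

lemma ae_frequently_eq (hq : ∀ j, M ≤ j → (q j : ℝ) = 1 / 2) (b : Bool) :
    ∀ᵐ s ∂stackMeasure q, ∃ᶠ i in atTop, s i = b := by
  refine ae_frequently_stack b (c := ENNReal.ofReal (1 / 2)) (by simp) ?_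
  filter_upwards [eventually_ge_atTop M] with j hj
  cases b
  · rw [coin_false, hq j hj]; norm_num
  · rw [coin_true, hq j hj]

lemma ae_forall_frequently_eq (hq : ∀ j, M ≤ j → (q j : ℝ) = 1 / 2) (b : Bool) :
    ∀ᵐ σ ∂envMeasure q, ∀ x, ∃ᶠ i in atTop, σ x i = b :=
  ae_all_iff.2 fun x => (measurePreserving_env x).quasiMeasurePreserving.ae (ae_frequently_eq hq b)

/-- The generating function at `θ` of the number of right steps before the `n`-th left step, in a
stack deprived of its first `j` instructions. -/
noncomputable def pgf (q : ℕ → unitInterval) (θ : ℝ) (j n : ℕ) : ℝ :=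
  ∫ s, θ ^ offspring (drop s j) n ∂stackMeasure q

lemma pgf_zero (θ : ℝ) (j : ℕ) : pgf q θ j 0 = 1 := by simp [pgf]

lemma abs_pgf_le {θ : ℝ} (hθ : θ ∈ Set.Icc (0 : ℝ) 1) (j n : ℕ) : |pgf q θ j n| ≤ 1 := by
  have := norm_integral_le_of_norm_le_const (μ := stackMeasure q) (C := 1)
    (f := fun s => θ ^ offspring (drop s j) n) (ae_of_all _ fun s => by
      rw [Real.norm_eq_abs, abs_of_nonneg (pow_nonneg hθ.1 _)]
      exact pow_le_one₀ hθ.1 hθ.2)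
  simpa [pgf] using this

lemma pgf_succ (hq : ∀ j, M ≤ j → (q j : ℝ) = 1 / 2) {θ : ℝ} (hθ : θ ∈ Set.Icc (0 : ℝ) 1)
    (j n : ℕ) : pgf q θ j (n + 1)
      = q j * (θ * pgf q θ (j + 1) (n + 1)) + (1 - q j) * pgf q θ (j + 1) n := by
  let F : Bool × (ℕ → Bool) → ℝ := fun z =>
    if z.1 then θ ^ (offspring z.2 (n + 1) + 1) else θ ^ offspring z.2 n
  have hF : Measurable F := by
    refine Measurable.ite (measurableSet_eq_fun measurable_fst measurable_const) ?_ ?_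
    · exact measurable_from_nat.comp (((measurable_offspring _).comp measurable_snd).add_const 1)
    · exact measurable_from_nat.comp ((measurable_offspring _).comp measurable_snd)
  have hC : ∀ z, |F z| ≤ 1 := fun z => by
    simp only [F]
    split_ifs <;> rw [abs_of_nonneg (pow_nonneg hθ.1 _)] <;> exact pow_le_one₀ hθ.1 hθ.2
  have hi : IndepFun (fun s : ℕ → Bool => s j) (fun s => drop s (j + 1)) (stackMeasure q) :=
    indepFun_subfamily (fun i => measurable_pi_apply i) iIndepFun_stack j (fun k => j + 1 + k)
      fun k => by omega
  calc pgf q θ j (n + 1) = ∫ s, F (s j, drop s (j + 1)) ∂stackMeasure q := by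
        refine integral_congr_ae ?_
        filter_upwards [ae_frequently_eq hq false] with s hs
        have hs' : ∃ᶠ i in atTop, drop s j i = false := by
          rw [← map_add_atTop_eq_nat j] at hs
          exact (frequently_map.1 hs).mono fun i hi => by rwa [drop, add_comm]
        have e : drop (drop s j) 1 = drop s (j + 1) := by ext i; simp [drop, add_assoc]
        simp only [offspring_succ hs', e, F]
        simp only [drop, add_zero]
        split_ifs <;> rfl
    _ = ∫ s, ∫ s', F (s j, drop s' (j + 1)) ∂stackMeasure q ∂stackMeasure q :=
        integral_comp_indepFun (measurable_pi_apply j) (measurable_drop _) hi hF hC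
    _ = ∫ b, ∫ s', F (b, drop s' (j + 1)) ∂stackMeasure q ∂coin (q j) := by
        rw [← (measurePreserving_stack j).map_eq,
          integral_map (measurable_pi_apply j).aemeasurable
            (measurable_of_finite _).aestronglyMeasurable]
    _ = _ := by
        rw [integral_coin]
        simp only [F, pgf, if_true, pow_succ', Bool.false_eq_true, if_false]
        rw [integral_const_mul]

lemma pgf_of_le (hq : ∀ j, M ≤ j → (q j : ℝ) = 1 / 2) {θ : ℝ} (hθ : θ ∈ Set.Icc (0 : ℝ) 1)
    (n : ℕ) : ∀ j, M ≤ j → pgf q θ j n = (2 - θ)⁻¹ ^ n := by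
  have h2 : (2 - θ) ≠ 0 := by linarith [hθ.2]
  induction n with
  | zero => simp [pgf_zero]
  | succ n ih =>
    have h : ∀ k : ℕ, ∀ j, M ≤ j → |pgf q θ j (n + 1) - (2 - θ)⁻¹ ^ (n + 1)| ≤ 2 * (1 / 2) ^ k := by
      intro k
      induction k with
      | zero =>
        intro j _
        have h0 : 0 ≤ (2 - θ)⁻¹ := inv_nonneg.2 (by linarith [hθ.2])
        have h1 : (2 - θ)⁻¹ ≤ 1 := inv_le_one_of_one_le₀ (by linarith [hθ.2])
        have h3 := abs_pgf_le (q := q) hθ j (n + 1)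
        have h4 := pow_nonneg h0 (n + 1)
        have h5 := pow_le_one₀ (n := n + 1) h0 h1
        rw [abs_le] at h3 ⊢
        constructor <;> linarith
      | succ k ihk =>
        intro j hj
        have e : pgf q θ j (n + 1) - (2 - θ)⁻¹ ^ (n + 1)
            = θ / 2 * (pgf q θ (j + 1) (n + 1) - (2 - θ)⁻¹ ^ (n + 1)) := by
          rw [pgf_succ hq hθ, hq j hj, ih (j + 1) (by omega), pow_succ]
          linear_combination -(2 - θ)⁻¹ ^ n / 2 * mul_inv_cancel₀ h2
        rw [e, abs_mul, abs_of_nonneg (by linarith [hθ.1]), pow_succ (1 / 2 : ℝ) k]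
        have := ihk (j + 1) (by omega)
        have h0 := abs_nonneg (pgf q θ (j + 1) (n + 1) - (2 - θ)⁻¹ ^ (n + 1))
        nlinarith [hθ.1, hθ.2]
    intro j hj
    have hlim : Tendsto (fun k : ℕ => 2 * (1 / 2 : ℝ) ^ k) atTop (𝓝 (2 * 0)) :=
      (tendsto_pow_atTop_nhds_zero_of_lt_one (by norm_num) (by norm_num)).const_mul 2
    rw [mul_zero] at hlim
    have := ge_of_tendsto' hlim fun k => h k j hj
    exact sub_eq_zero.1 (abs_eq_zero.1 (le_antisymm this (abs_nonneg _)))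

lemma pgf_eq (hq : ∀ j, M ≤ j → (q j : ℝ) = 1 / 2) {θ : ℝ} (hθ : θ ∈ Set.Icc (0 : ℝ) 1)
    (k : ℕ) : ∀ j n, j + k = M → k ≤ n → pgf q θ j n
      = (2 - θ)⁻¹ ^ n * ∏ l ∈ Finset.Ico j M, (1 - (2 * (q l : ℝ) - 1) * (1 - θ)) := by
  have h2 : (2 - θ) ≠ 0 := by linarith [hθ.2]
  induction k with
  | zero =>
    rintro j n rfl -
    simpa using pgf_of_le hq hθ n j le_rfl
  | succ k ih =>
    rintro j n rfl hn
    obtain ⟨n, rfl⟩ := Nat.exists_eq_add_one.2 (Nat.zero_lt_of_lt hn)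
    rw [pgf_succ hq hθ, ih (j + 1) (n + 1) (by omega) (by omega),
      ih (j + 1) n (by omega) (by omega),
      Finset.prod_eq_prod_Ico_succ_bot (by omega : j < j + (k + 1)),
      pow_succ]
    generalize ∏ l ∈ Finset.Ico (j + 1) (j + (k + 1)), (1 - (2 * (q l : ℝ) - 1) * (1 - θ)) = A
    linear_combination -(2 - θ)⁻¹ ^ n * A * (1 - q j) * mul_inv_cancel₀ h2

/-- The expectation of a function of the offspring of `n` individuals. -/
noncomputable def step (q : ℕ → unitInterval) (g : ℕ → ℝ) (n : ℕ) : ℝ :=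
  ∫ s, g (offspring s n) ∂stackMeasure q

lemma step_pow (hq : ∀ j, M ≤ j → (q j : ℝ) = 1 / 2) {n : ℕ} (hn : M ≤ n) (i : ℕ) :
    step q (fun m => ((i : ℝ) / (i + 1)) ^ m) n
      = (∏ l ∈ Finset.range M, (1 - (2 * (q l : ℝ) - 1) / (i + 1)))
        * (((i + 1 : ℕ) : ℝ) / ((i + 1 : ℕ) + 1)) ^ n := by
  have hi : (0 : ℝ) < i + 1 := by positivity
  have h := pgf_eq (q := q) hq (θ := (i : ℝ) / (i + 1))
    ⟨by positivity, (div_le_one hi).2 (by linarith)⟩ M 0 n (by omega) hn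
  have e : ∀ s : ℕ → Bool, drop s 0 = s := fun s => by ext i; simp [drop]
  simp only [pgf, e] at h
  rw [step, h, mul_comm, Finset.range_eq_Ico]
  congr 1
  · refine Finset.prod_congr rfl fun l _ => ?_
    rw [show 1 - (i : ℝ) / (i + 1) = 1 / (i + 1) by field_simp; ring, mul_one_div]
  · rw [show 2 - (i : ℝ) / (i + 1) = ((i + 1 : ℕ) + 1) / ((i + 1 : ℕ) : ℝ) by
      rw [eq_div_iff (by positivity)]; push_cast; field_simp; ring, inv_div]

end Step

/-! ### Survival probabilities -/

section Survival

lemma abs_le_of_mem_Icc {x : ℝ} (hx : x ∈ Set.Icc (0 : ℝ) 1) : |x| ≤ 1 :=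
  abs_le.2 ⟨by linarith [hx.1], hx.2⟩

lemma integrable_offspring {g : ℕ → ℝ} {C : ℝ} (hC : ∀ m, |g m| ≤ C) (n : ℕ) :
    Integrable (fun s => g (offspring s n)) (stackMeasure q) :=
  Integrable.of_bound (measurable_from_nat.comp (measurable_offspring n)).aestronglyMeasurable C
    (ae_of_all _ fun _ => hC _)

lemma measure_forall_lt_pos (hq : ∀ j, (q j : ℝ) ∈ Set.Ioo (0 : ℝ) 1) (N : ℕ) (b : ℕ → Bool) :
    0 < (stackMeasure q).real {s | ∀ i < N, s i = b i} := by
  have e : {s : ℕ → Bool | ∀ i < N, s i = b i} = Set.pi (Finset.range N) fun i => {b i} := by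
    ext s; simp [Set.mem_pi]
  rw [measureReal_def, e, stackMeasure,
    Measure.infinitePi_pi _ fun _ _ => measurableSet_singleton _,
    ENNReal.toReal_prod]
  refine Finset.prod_pos fun i _ => ?_
  cases b i
  · rw [coin_false, ENNReal.toReal_ofReal (by linarith [(hq i).2])]
    linarith [(hq i).2]
  · rw [coin_true, ENNReal.toReal_ofReal (hq i).1.le]
    exact (hq i).1

lemma measurableSet_offspring_eq (n m : ℕ) : MeasurableSet {s : ℕ → Bool | offspring s n = m} :=
  measurableSet_eq_fun (measurable_offspring n) measurable_const

lemma measure_offspring_eq_zero_pos (hq : ∀ j, (q j : ℝ) ∈ Set.Ioo (0 : ℝ) 1) (n : ℕ) :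
    0 < (stackMeasure q).real {s | offspring s n = 0} := by
  refine (measure_forall_lt_pos hq n fun _ => false).trans_le
    (measureReal_mono fun s (hs : ∀ i < n, s i = false) => ?_)
  have h0 : heads s n = 0 := by
    rw [heads, Nat.count_eq_card_filter_range, Finset.card_eq_zero, Finset.filter_eq_empty_iff]
    intro i hi
    simp [hs i (Finset.mem_range.1 hi)]
  have h1 := heads_add_tails s n
  exact Nat.le_zero.1 ((offspring_le_heads (by omega : n ≤ tails s n)).trans h0.le)

lemma measure_offspring_one_eq_pos (hq : ∀ j, (q j : ℝ) ∈ Set.Ioo (0 : ℝ) 1) (m : ℕ) :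
    0 < (stackMeasure q).real {s | offspring s 1 = m} := by
  refine (measure_forall_lt_pos hq (m + 1) fun i => decide (i < m)).trans_le
    (measureReal_mono fun s (hs : ∀ i < m + 1, s i = decide (i < m)) => ?_)
  have h0 : tails s m = 0 := by
    rw [tails, Nat.count_eq_card_filter_range, Finset.card_eq_zero, Finset.filter_eq_empty_iff]
    intro i hi
    have := Finset.mem_range.1 hi
    simp [hs i (by omega), this]
  have h1 := heads_add_tails s m
  have h2 : s m = false := by simp [hs m (by omega)]
  have h3 : tails s (m + 1) = 0 + 1 := by
    rw [tails, Nat.count_succ, ← tails, h0]; simp [h2]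
  have := offspring_eq_heads h3 h2
  rw [zero_add] at this
  simp only [Set.mem_ofPred_eq]
  omega

lemma step_lt (hq : ∀ j, (q j : ℝ) ∈ Set.Ioo (0 : ℝ) 1) {g : ℕ → ℝ} {B C : ℝ}
    (hB : ∀ m, |g m| ≤ B) (hC : ∀ m, g m ≤ C) (h0 : g 0 < C) (n : ℕ) : step q g n < C := by
  have hm := measurableSet_offspring_eq n 0
  have hpos := measure_offspring_eq_zero_pos hq n
  have h1 : step q g n ≤ ∫ s, (C - {s | offspring s n = 0}.indicator (fun _ => C - g 0) s)
      ∂stackMeasure q := by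
    refine integral_mono (integrable_offspring hB n)
      ((integrable_const _).sub ((integrable_const _).indicator hm)) fun s => ?_
    simp only [Set.indicator_apply, Set.mem_ofPred_eq]
    split_ifs with h
    · simp [h]
    · simpa using hC _
  rw [integral_sub (integrable_const _) ((integrable_const _).indicator hm),
    integral_indicator_const _ hm] at h1
  simp only [integral_const, probReal_univ, smul_eq_mul, one_mul] at h1
  nlinarith [mul_pos hpos (sub_pos.2 h0)]

/-- The probability that the branching chain started from `n` individuals survives `K`
generations. -/
noncomputable def surv (q : ℕ → unitInterval) : ℕ → ℕ → ℝ
  | 0, n => if n = 0 then 0 else 1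
  | K + 1, n => step q (surv q K) n

lemma chain_congr {σ τ : ℤ → ℕ → Bool} (K : ℕ) :
    ∀ {k : ℤ} {n : ℕ}, (∀ x, k ≤ x → σ x = τ x) → chain σ k n K = chain τ k n K := by
  induction K with
  | zero => intros; rfl
  | succ K ih =>
    intro k n h
    rw [chain, chain, h k le_rfl, ih fun x hx => h x (by omega)]

lemma measurableSet_chain_ne_zero (k : ℤ) (n K : ℕ) :
    MeasurableSet {σ : ℤ → ℕ → Bool | chain σ k n K ≠ 0} :=
  (measurableSet_eq_fun (measurable_chain k n K) measurable_const).compl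

lemma measure_chain_ne_zero (K : ℕ) : ∀ (k : ℤ) (n : ℕ),
    (envMeasure q).real {σ | chain σ k n K ≠ 0} = surv q K n := by
  induction K with
  | zero =>
    intro k n
    by_cases h : n = 0 <;> simp [chain, surv, h]
  | succ K ih =>
    intro k n
    let F : (ℕ → Bool) × (ℤ → ℕ → Bool) → ℝ := fun z =>
      {τ | chain τ (k + 1) (offspring z.1 n) K ≠ 0}.indicator 1 z.2
    have hF : Measurable F := by
      have h1 : Measurable fun z : (ℤ → ℕ → Bool) × ℕ => chain z.1 (k + 1) z.2 K :=
        measurable_from_prod_countable_left fun m => measurable_chain _ m K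
      have h2 : Measurable fun z : (ℕ → Bool) × (ℤ → ℕ → Bool) =>
          chain z.2 (k + 1) (offspring z.1 n) K :=
        h1.comp (measurable_snd.prodMk ((measurable_offspring n).comp measurable_fst))
      exact Measurable.ite (measurableSet_eq_fun h2 measurable_const).compl measurable_const
        measurable_const
    have hC : ∀ z, |F z| ≤ 1 := fun z => by
      simp only [F, Set.indicator_apply]
      split_ifs <;> simp
    have hi := indepFun_subfamily (fun x => measurable_pi_apply x) (iIndepFun_env (q := q)) k
      (fun x => max x (k + 1)) fun x => by omega
    have hB : Measurable fun (σ : ℤ → ℕ → Bool) x => σ (max x (k + 1)) :=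
      measurable_pi_lambda _ fun x => measurable_pi_apply _
    have hcongr : ∀ (σ : ℤ → ℕ → Bool) m,
        chain (fun x => σ (max x (k + 1))) (k + 1) m K = chain σ (k + 1) m K := fun σ m =>
      chain_congr K fun x hx => by simp only [max_eq_left hx]
    calc (envMeasure q).real {σ | chain σ k n (K + 1) ≠ 0}
        = ∫ σ, F (σ k, fun x => σ (max x (k + 1))) ∂envMeasure q := by
          rw [← integral_indicator_one (measurableSet_chain_ne_zero k n (K + 1))]
          refine integral_congr_ae (ae_of_all _ fun σ => ?_)
          simp only [F, Set.indicator_apply, Set.mem_ofPred_eq, hcongr, Pi.one_apply]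
          simp only [chain]
          congr
      _ = ∫ σ, ∫ σ', F (σ k, fun x => σ' (max x (k + 1))) ∂envMeasure q ∂envMeasure q :=
          integral_comp_indepFun (measurable_pi_apply k) hB hi hF hC
      _ = ∫ σ, surv q K (offspring (σ k) n) ∂envMeasure q := by
          refine integral_congr_ae (ae_of_all _ fun σ => ?_)
          simp only
          rw [← ih (k + 1), ← integral_indicator_one (measurableSet_chain_ne_zero _ _ K)]
          refine integral_congr_ae (ae_of_all _ fun σ' => ?_)
          simp only [F, Set.indicator_apply, Set.mem_ofPred_eq, hcongr, Pi.one_apply]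
      _ = surv q (K + 1) n := by
          rw [surv, step, ← (measurePreserving_env (q := q) k).map_eq,
            integral_map (measurable_pi_apply k).aemeasurable
              (measurable_from_nat.comp (measurable_offspring n)).aestronglyMeasurable]

lemma surv_mem_Icc (K n : ℕ) : surv q K n ∈ Set.Icc (0 : ℝ) 1 := by
  rw [← measure_chain_ne_zero K 0 n]
  exact ⟨measureReal_nonneg, measureReal_le_one⟩

/-- The probability that the branching chain started from `n` individuals survives forever. -/
noncomputable def survForever (q : ℕ → unitInterval) (n : ℕ) : ℝ :=
  (envMeasure q).real {σ | ∀ K, chain σ 0 n K ≠ 0}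

lemma tendsto_surv (k : ℤ) (n : ℕ) : Tendsto (fun K => surv q K n) atTop
    (𝓝 ((envMeasure q).real {σ | ∀ K, chain σ k n K ≠ 0})) := by
  have h := tendsto_measure_iInter_atTop (μ := envMeasure q)
    (fun K => (measurableSet_chain_ne_zero k n K).nullMeasurableSet) (chain_antitone k n)
    ⟨0, measure_ne_top _ _⟩
  have e : {σ : ℤ → ℕ → Bool | ∀ K, chain σ k n K ≠ 0} = ⋂ K, {σ | chain σ k n K ≠ 0} := by
    ext; simp
  rw [e, measureReal_def]
  simp only [← measure_chain_ne_zero _ k n]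
  exact (ENNReal.tendsto_toReal (measure_ne_top _ _)).comp h

lemma measure_forall_chain_ne_zero (k : ℤ) (n : ℕ) :
    (envMeasure q).real {σ | ∀ K, chain σ k n K ≠ 0} = survForever q n :=
  tendsto_nhds_unique (tendsto_surv k n) (tendsto_surv 0 n)

lemma survForever_mem_Icc (n : ℕ) : survForever q n ∈ Set.Icc (0 : ℝ) 1 :=
  ⟨measureReal_nonneg, measureReal_le_one⟩

lemma survForever_zero : survForever q 0 = 0 := by
  have : {σ | ∀ K, chain σ 0 0 K ≠ 0} = ∅ := by
    ext σ
    simp only [Set.mem_ofPred_eq, Set.mem_empty_iff_false, iff_false, not_forall]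
    exact ⟨0, by simp [chain]⟩
  rw [survForever, this, measureReal_empty]

lemma step_survForever (n : ℕ) : step q (survForever q) n = survForever q n := by
  refine tendsto_nhds_unique (f := fun K => surv q (K + 1) n) (l := atTop) ?_
    ((tendsto_surv 0 n).comp (tendsto_add_atTop_nat 1))
  exact tendsto_integral_of_dominated_convergence (fun _ => 1)
    (fun K => (measurable_from_nat.comp (measurable_offspring n)).aestronglyMeasurable)
    (integrable_const _) (fun K => ae_of_all _ fun s => abs_le_of_mem_Icc (surv_mem_Icc _ _))
    (ae_of_all _ fun s => tendsto_surv 0 _)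

end Survival

/-! ### The weights -/

section Weight

variable {M : ℕ}

/-- The factor relating consecutive weights. -/
noncomputable def factor (q : ℕ → unitInterval) (M i : ℕ) : ℝ :=
  ∏ l ∈ Finset.range M, (1 - (2 * (q l : ℝ) - 1) / (i + 1))

/-- The weights of the geometric functions in the harmonic function of the branching chain. -/
noncomputable def weight (q : ℕ → unitInterval) (M i : ℕ) : ℝ :=
  ∏ k ∈ Finset.range i, factor q M k

/-- The total drift of the first `M` cookies. -/
noncomputable def drift (q : ℕ → unitInterval) (M : ℕ) : ℝ :=
  ∑ l ∈ Finset.range M, (2 * (q l : ℝ) - 1)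

lemma weight_zero : weight q M 0 = 1 := by simp [weight]

lemma weight_succ (i : ℕ) : weight q M (i + 1) = weight q M i * factor q M i :=
  Finset.prod_range_succ _ _

lemma one_sub_pos_of_mem_Ioo {x : ℝ} (hx : x ∈ Set.Ioo (0 : ℝ) 1) (i : ℕ) :
    0 < 1 - (2 * x - 1) / ((i : ℝ) + 1) := by
  have hi : (0 : ℝ) ≤ i := i.cast_nonneg
  rw [sub_pos, div_lt_one (by positivity)]
  linarith [hx.2]

lemma factor_pos (hq : ∀ j, (q j : ℝ) ∈ Set.Ioo (0 : ℝ) 1) (i : ℕ) : 0 < factor q M i :=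
  Finset.prod_pos fun l _ => one_sub_pos_of_mem_Ioo (hq l) i

lemma weight_pos (hq : ∀ j, (q j : ℝ) ∈ Set.Ioo (0 : ℝ) 1) (i : ℕ) : 0 < weight q M i :=
  Finset.prod_pos fun k _ => factor_pos hq k

lemma factor_le_exp (hq : ∀ j, (q j : ℝ) ∈ Set.Ioo (0 : ℝ) 1) (i : ℕ) :
    factor q M i ≤ Real.exp (-(drift q M / (i + 1))) := by
  rw [drift, Finset.sum_div, ← Finset.sum_neg_distrib, Real.exp_sum]
  exact Finset.prod_le_prod (fun l _ => (one_sub_pos_of_mem_Ioo (hq l) i).le)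
    fun l _ => Real.one_sub_le_exp_neg _

lemma exp_neg_sub_le_one_sub {x : ℝ} (hx : x ≤ 1 / 2) : Real.exp (-x - 2 * x ^ 2) ≤ 1 - x := by
  have h0 : 0 < 1 - x := by linarith
  rw [← Real.le_log_iff_exp_le h0]
  refine le_trans ?_ (Real.one_sub_inv_le_log_of_pos h0)
  rw [← sub_nonneg]
  have : 1 - (1 - x)⁻¹ - (-x - 2 * x ^ 2) = x ^ 2 * (1 - 2 * x) / (1 - x) := by
    field_simp
    ring
  rw [this]
  exact div_nonneg (mul_nonneg (sq_nonneg x) (by linarith)) h0.le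

lemma exp_le_factor (hq : ∀ j, (q j : ℝ) ∈ Set.Ioo (0 : ℝ) 1) {i : ℕ} (hi : 1 ≤ i) :
    Real.exp (-(drift q M / (i + 1)) - 2 * M * (1 / ((i : ℝ) + 1) ^ 2)) ≤ factor q M i := by
  have hi' : (1 : ℝ) ≤ i := by exact_mod_cast hi
  have e : -(drift q M / (i + 1)) - 2 * M * (1 / ((i : ℝ) + 1) ^ 2)
      = ∑ l ∈ Finset.range M, (-((2 * (q l : ℝ) - 1) / (i + 1)) - 2 * (1 / ((i : ℝ) + 1) ^ 2)) := by
    rw [Finset.sum_sub_distrib, Finset.sum_neg_distrib, ← Finset.sum_div, drift]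
    simp
    ring
  rw [e, Real.exp_sum]
  refine Finset.prod_le_prod (fun l _ => (Real.exp_pos _).le) fun l _ => ?_
  refine le_trans (Real.exp_le_exp.2 ?_) (exp_neg_sub_le_one_sub ?_)
  · have h1 : (2 * (q l : ℝ) - 1) ^ 2 ≤ 1 := by nlinarith [(hq l).1, (hq l).2]
    have h2 := div_le_div_of_nonneg_right h1 (by positivity : 0 ≤ ((i : ℝ) + 1) ^ 2)
    rw [div_pow]
    linarith
  · rw [div_le_div_iff₀ (by positivity) (by positivity)]
    linarith [(hq l).2]

lemma summable_weight (hq : ∀ j, (q j : ℝ) ∈ Set.Ioo (0 : ℝ) 1) (hd : 1 < drift q M) :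
    Summable (weight q M) := by
  have h : ∀ i : ℕ, weight q M i ≤ ((i + 1 : ℕ) : ℝ) ^ (-drift q M) := by
    intro i
    rw [Real.rpow_def_of_pos (by positivity)]
    induction i with
    | zero => simp [weight_zero]
    | succ i ih =>
      have hlog : Real.log ((i + 1 + 1 : ℕ) : ℝ) - Real.log ((i + 1 : ℕ) : ℝ) ≤ 1 / (i + 1) := by
        rw [← Real.log_div (by positivity) (by positivity)]
        refine (Real.log_le_sub_one_of_pos (by positivity)).trans_eq ?_
        push_cast
        field_simp
        ring
      calc weight q M (i + 1) ≤ Real.exp (Real.log ((i + 1 : ℕ) : ℝ) * -drift q M)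
            * Real.exp (-(drift q M / (i + 1))) := by
            rw [weight_succ]
            exact mul_le_mul ih (factor_le_exp hq i) (factor_pos hq i).le (Real.exp_pos _).le
        _ ≤ _ := by
            rw [← Real.exp_add]
            refine Real.exp_le_exp.2 ?_
            rw [div_eq_mul_one_div (drift q M)]
            nlinarith
  exact Summable.of_nonneg_of_le (fun i => (weight_pos hq i).le) h
    ((summable_nat_add_iff 1).2 (Real.summable_nat_rpow.2 (by linarith)))

lemma tendsto_sum_weight (hq : ∀ j, (q j : ℝ) ∈ Set.Ioo (0 : ℝ) 1) (hd : drift q M ≤ 1) :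
    Tendsto (fun L => ∑ i ∈ Finset.range L, weight q M i) atTop atTop := by
  rw [← not_summable_iff_tendsto_nat_atTop_of_nonneg fun i => (weight_pos hq i).le]
  have h : ∀ i : ℕ, weight q M 1 * Real.exp (-Real.log (i + 1) - 2 * M * (1 - 1 / (i + 1)))
      ≤ weight q M (i + 1) := by
    intro i
    induction i with
    | zero => simp
    | succ i ih =>
      have h1 : 1 / ((i : ℝ) + 1 + 1) ≤ Real.log (i + 1 + 1) - Real.log (i + 1) := by
        rw [← Real.log_div (by positivity) (by positivity)]
        refine Eq.trans_le ?_ (Real.one_sub_inv_le_log_of_pos (by positivity))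
        field_simp
        ring
      have h2 : 1 / ((i : ℝ) + 1 + 1) ^ 2 ≤ 1 / (i + 1) - 1 / (i + 1 + 1) := by
        rw [div_sub_div _ _ (by positivity) (by positivity),
          div_le_div_iff₀ (by positivity) (by positivity)]
        nlinarith [(i.cast_nonneg : (0 : ℝ) ≤ i)]
      have h3 := exp_le_factor (M := M) hq (Nat.succ_pos i)
      rw [weight_succ (i + 1)]
      refine le_trans ?_ (mul_le_mul ih h3 (Real.exp_pos _).le (weight_pos hq _).le)
      rw [mul_assoc (weight q M 1), ← Real.exp_add]
      refine mul_le_mul_of_nonneg_left (Real.exp_le_exp.2 ?_) (weight_pos hq _).le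
      push_cast
      have h4 : drift q M / ((i : ℝ) + 1 + 1) ≤ 1 / (i + 1 + 1) :=
        div_le_div_of_nonneg_right hd (by positivity)
      have h5 := mul_le_mul_of_nonneg_left h2 (by positivity : (0 : ℝ) ≤ 2 * M)
      nlinarith
  intro hs
  have hs' := (summable_nat_add_iff 1).2 hs
  have hc : 0 < weight q M 1 * Real.exp (-(2 * M)) :=
    mul_pos (weight_pos hq 1) (Real.exp_pos _)
  have h' : ∀ i : ℕ, 0 ≤ 1 / ((i + 1 : ℕ) : ℝ) ∧
      1 / ((i + 1 : ℕ) : ℝ) ≤ (weight q M 1 * Real.exp (-(2 * M)))⁻¹ * weight q M (i + 1) := by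
    intro i
    refine ⟨by positivity, ?_⟩
    rw [le_inv_mul_iff₀ hc]
    refine le_trans ?_ (h i)
    have h6 : Real.exp (-Real.log (i + 1)) = 1 / ((i + 1 : ℕ) : ℝ) := by
      rw [Real.exp_neg, Real.exp_log (by positivity)]; simp
    rw [← h6, mul_assoc (weight q M 1), ← Real.exp_add]
    refine mul_le_mul_of_nonneg_left (Real.exp_le_exp.2 ?_) (weight_pos hq _).le
    have : (0 : ℝ) ≤ 2 * M * (1 / (i + 1)) := by positivity
    nlinarith
  have := Summable.of_nonneg_of_le (fun i => (h' i).1) (fun i => (h' i).2) (hs'.mul_left _)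
  exact Real.not_summable_one_div_natCast ((summable_nat_add_iff 1).1 this)

end Weight

/-! ### Survival criterion -/

section Criterion

variable {M : ℕ}

/-- The function `n ↦ (i / (i + 1)) ^ n`. -/
noncomputable def geo (i n : ℕ) : ℝ := ((i : ℝ) / (i + 1)) ^ n

lemma ratio_nonneg (i : ℕ) : (0 : ℝ) ≤ (i : ℝ) / (i + 1) := by positivity

lemma ratio_lt_one (i : ℕ) : (i : ℝ) / (i + 1) < 1 := by
  rw [div_lt_one (by positivity)]; linarith

lemma geo_mem_Icc (i n : ℕ) : geo i n ∈ Set.Icc (0 : ℝ) 1 :=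
  ⟨pow_nonneg (ratio_nonneg i) n, pow_le_one₀ (ratio_nonneg i) (ratio_lt_one i).le⟩

lemma geo_antitone (i : ℕ) : Antitone (geo i) := fun _ _ h =>
  pow_le_pow_of_le_one (ratio_nonneg i) (ratio_lt_one i).le h

lemma geo_zero_left {n : ℕ} (hn : 1 ≤ n) : geo 0 n = 0 := by
  simp [geo, Nat.one_le_iff_ne_zero.1 hn]

lemma tendsto_geo (i : ℕ) : Tendsto (geo i) atTop (𝓝 0) :=
  tendsto_pow_atTop_nhds_zero_of_lt_one (ratio_nonneg i) (ratio_lt_one i)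

lemma tendsto_geo_left (n : ℕ) : Tendsto (fun i => geo i n) atTop (𝓝 1) := by
  have := (tendsto_natCast_div_add_atTop (1 : ℝ)).pow n
  rwa [one_pow] at this

lemma weight_mul_step_geo (hq : ∀ j, M ≤ j → (q j : ℝ) = 1 / 2) {n : ℕ} (hn : M ≤ n) (i : ℕ) :
    weight q M i * step q (geo i) n = weight q M (i + 1) * geo (i + 1) n := by
  rw [weight_succ, mul_assoc]
  congr 1
  exact step_pow hq hn i

/-- A function which is superharmonic above `M` for the branching chain. -/
noncomputable def potential (q : ℕ → unitInterval) (M L n : ℕ) : ℝ :=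
  ∑ i ∈ Finset.range L, weight q M i * (1 - geo i n)

lemma potential_mem_Icc (hq : ∀ j, (q j : ℝ) ∈ Set.Ioo (0 : ℝ) 1) (L n : ℕ) :
    potential q M L n ∈ Set.Icc 0 (∑ i ∈ Finset.range L, weight q M i) := by
  refine ⟨Finset.sum_nonneg fun i _ => mul_nonneg (weight_pos hq i).le ?_,
    Finset.sum_le_sum fun i _ => mul_le_of_le_one_right (weight_pos hq i).le ?_⟩
  · linarith [(geo_mem_Icc i n).2]
  · linarith [(geo_mem_Icc i n).1]

lemma potential_zero (L : ℕ) : potential q M L 0 = 0 := by simp [potential, geo]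

lemma step_potential_le (hM : 1 ≤ M) (hq : ∀ j, M ≤ j → (q j : ℝ) = 1 / 2)
    (hq' : ∀ j, (q j : ℝ) ∈ Set.Ioo (0 : ℝ) 1) (L : ℕ) {n : ℕ} (hn : M ≤ n) :
    step q (potential q M L) n ≤ potential q M L n := by
  have hint : ∀ i, Integrable (fun s => geo i (offspring s n)) (stackMeasure q) := fun i =>
    integrable_offspring (fun m => abs_le_of_mem_Icc (geo_mem_Icc i m)) n
  have h1 : step q (potential q M L) n
      = ∑ i ∈ Finset.range L, (weight q M i - weight q M (i + 1) * geo (i + 1) n) := by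
    simp only [step, potential]
    have hint' : ∀ i, Integrable (fun s => weight q M i * (1 - geo i (offspring s n)))
        (stackMeasure q) := fun i => ((integrable_const _).sub (hint i)).const_mul _
    rw [integral_finsetSum _ fun i _ => hint' i]
    refine Finset.sum_congr rfl fun i _ => ?_
    rw [integral_const_mul, integral_sub (integrable_const _) (hint i),
      ← weight_mul_step_geo hq hn, step]
    simp
    ring
  have h2 : ∑ i ∈ Finset.range L, weight q M i * geo i n
      ≤ ∑ i ∈ Finset.range L, weight q M (i + 1) * geo (i + 1) n := by
    have h3 := Finset.sum_range_succ' (fun i => weight q M i * geo i n) L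
    rw [Finset.sum_range_succ, geo_zero_left (hM.trans hn)] at h3
    linarith [mul_nonneg (weight_pos hq' L (M := M)).le (geo_mem_Icc L n).1]
  rw [h1, potential, Finset.sum_sub_distrib]
  simp only [mul_sub, mul_one, Finset.sum_sub_distrib]
  linarith

lemma tendsto_potential (L : ℕ) : Tendsto (potential q M L) atTop
    (𝓝 (∑ i ∈ Finset.range L, weight q M i)) := by
  refine tendsto_finsetSum _ fun i _ => ?_
  simpa using ((tendsto_geo i).const_sub 1).const_mul (weight q M i)

lemma survForever_le (hM : 1 ≤ M) (hq : ∀ j, M ≤ j → (q j : ℝ) = 1 / 2)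
    (hq' : ∀ j, (q j : ℝ) ∈ Set.Ioo (0 : ℝ) 1) {m : ℝ} (hm₀ : 0 ≤ m)
    (hm : ∀ j < M, survForever q j ≤ m) {L : ℕ} (hL : 1 ≤ L) (n : ℕ) :
    survForever q n ≤ m + 2 * (potential q M L n / ∑ i ∈ Finset.range L, weight q M i) := by
  set W := ∑ i ∈ Finset.range L, weight q M i with hW
  have hWpos : 0 < W := Finset.sum_pos (fun i _ => weight_pos hq' i) ⟨0, Finset.mem_range.2 hL⟩
  let ψ : ℕ → ℝ := fun n => survForever q n - (m + 2 / W * potential q M L n)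
  have hpos : ∀ n, 0 ≤ 2 / W * potential q M L n := fun n =>
    mul_nonneg (by positivity) (potential_mem_Icc hq' L n).1
  have hbd : ∀ n, 2 / W * potential q M L n ≤ 2 := fun n => by
    rw [div_mul_eq_mul_div, div_le_iff₀ hWpos]
    linarith [(potential_mem_Icc hq' L n (M := M)).2]
  have hψ : ∀ n, |ψ n| ≤ m + 3 := fun n => by
    have := survForever_mem_Icc (q := q) n
    have := hpos n
    have := hbd n
    simp only [ψ, abs_le]
    constructor <;> linarith [(survForever_mem_Icc (q := q) n).1,
      (survForever_mem_Icc (q := q) n).2]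
  suffices h : ∀ n, ψ n ≤ 0 by
    have := h n
    simp only [ψ] at this
    rw [← mul_div_assoc, ← div_mul_eq_mul_div]
    linarith
  by_contra! hex
  obtain ⟨n₁, hn₁⟩ := hex
  obtain ⟨N, hN⟩ : ∃ N, ∀ n ≥ N, ψ n ≤ 0 := by
    have h1 : Tendsto (fun n => 2 / W * potential q M L n) atTop (𝓝 2) := by
      have := (tendsto_potential (q := q) (M := M) L).const_mul (2 / W)
      rwa [← hW, div_mul_cancel₀ _ hWpos.ne'] at this
    obtain ⟨N, hN⟩ :=
      (h1.eventually (eventually_ge_nhds (by norm_num : (1 : ℝ) < 2))).exists_forall_of_atTop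
    refine ⟨N, fun n hn => ?_⟩
    simp only [ψ]
    linarith [hN n hn, (survForever_mem_Icc (q := q) n).2]
  obtain ⟨n₂, -, hmax⟩ := Finset.exists_max_image (Finset.range (max N (n₁ + 1))) ψ
    ⟨n₁, by simp⟩
  have hn₂ : 0 < ψ n₂ := hn₁.trans_le (hmax n₁ (by simp))
  have hmax' : ∀ n, ψ n ≤ ψ n₂ := by
    intro n
    by_cases h : n < max N (n₁ + 1)
    · exact hmax n (Finset.mem_range.2 h)
    · exact (hN n (by omega)).trans hn₂.le
  have hn₂M : M ≤ n₂ := by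
    by_contra! h
    have := hm n₂ h
    have := hpos n₂
    simp only [ψ] at hn₂
    linarith
  have h0 : ψ 0 < ψ n₂ := by
    refine lt_of_le_of_lt ?_ hn₂
    simp only [ψ, survForever_zero, potential_zero]
    linarith
  have hlt := step_lt hq' hψ hmax' h0 n₂
  have hstep : step q ψ n₂ = survForever q n₂ - (m + 2 / W * step q (potential q M L) n₂) := by
    have hi1 := integrable_offspring (q := q)
      (fun n => abs_le_of_mem_Icc (survForever_mem_Icc (q := q) n)) n₂
    have hi2 := integrable_offspring (q := q) (g := potential q M L) (C := W) (fun n => by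
      rw [abs_of_nonneg (potential_mem_Icc hq' L n).1]; exact (potential_mem_Icc hq' L n).2) n₂
    rw [← step_survForever n₂]
    simp only [step, ψ]
    have hi3 : Integrable (fun s => m + 2 / W * potential q M L (offspring s n₂))
      (stackMeasure q) := (integrable_const _).add (hi2.const_mul _)
    rw [integral_sub hi1 hi3, integral_add (integrable_const _) (hi2.const_mul _),
      integral_const_mul]
    simp
  have := mul_le_mul_of_nonneg_left (step_potential_le hM hq hq' L hn₂M)
    (by positivity : 0 ≤ 2 / W)
  rw [hstep] at hlt
  simp only [ψ] at hlt
  linarith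

/-- The branching chain dies out when the total drift is at most one. -/
lemma survForever_eq_zero (hM : 1 ≤ M) (hq : ∀ j, M ≤ j → (q j : ℝ) = 1 / 2)
    (hq' : ∀ j, (q j : ℝ) ∈ Set.Ioo (0 : ℝ) 1) (hd : drift q M ≤ 1) (n : ℕ) :
    survForever q n = 0 := by
  obtain ⟨j₀, -, hj₀⟩ := Finset.exists_max_image (Finset.range M) (survForever q)
    ⟨0, Finset.mem_range.2 hM⟩
  have hle : ∀ n, survForever q n ≤ survForever q j₀ := by
    intro n
    have ho : (fun L => potential q M L n) =o[atTop]
        fun L => ∑ i ∈ Finset.range L, weight q M i := by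
      refine Asymptotics.IsLittleO.sum_range ?_ (fun i => (weight_pos hq' i).le)
        (tendsto_sum_weight hq' hd)
      refine (Asymptotics.isLittleO_iff_tendsto fun i h => absurd h (weight_pos hq' i).ne').2 ?_
      have h1 := (tendsto_geo_left n).const_sub 1
      rw [sub_self] at h1
      refine h1.congr fun i => ?_
      rw [mul_div_cancel_left₀ _ (weight_pos hq' i).ne']
    have hlim := (ho.tendsto_div_nhds_zero.const_mul 2).const_add (survForever q j₀)
    rw [mul_zero, add_zero] at hlim
    refine ge_of_tendsto hlim ?_
    filter_upwards [eventually_ge_atTop 1] with L hL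
    exact survForever_le hM hq hq' (survForever_mem_Icc _).1
      (fun j hj => hj₀ j (Finset.mem_range.2 hj)) hL n
  have h0 : survForever q j₀ = 0 := by
    by_contra h
    have hpos := lt_of_le_of_ne (survForever_mem_Icc (q := q) j₀).1 (Ne.symm h)
    have := step_lt hq' (fun m => abs_le_of_mem_Icc (survForever_mem_Icc (q := q) m)) hle
      (by rwa [survForever_zero]) j₀
    rw [step_survForever] at this
    exact lt_irrefl _ this
  exact le_antisymm (h0 ▸ hle n) (survForever_mem_Icc n).1

/-- A bounded function, harmonic above `M` for the branching chain, which tends to zero. -/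
noncomputable def decay (q : ℕ → unitInterval) (M n : ℕ) : ℝ := ∑' i, weight q M i * geo i n

lemma summable_decay (hq : ∀ j, (q j : ℝ) ∈ Set.Ioo (0 : ℝ) 1) (hd : 1 < drift q M) (n : ℕ) :
    Summable fun i => weight q M i * geo i n :=
  Summable.of_nonneg_of_le (fun i => mul_nonneg (weight_pos hq i).le (geo_mem_Icc i n).1)
    (fun i => mul_le_of_le_one_right (weight_pos hq i).le (geo_mem_Icc i n).2)
    (summable_weight hq hd)

lemma decay_antitone (hq : ∀ j, (q j : ℝ) ∈ Set.Ioo (0 : ℝ) 1) (hd : 1 < drift q M) :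
    Antitone (decay q M) := fun m n h =>
  (summable_decay hq hd n).tsum_le_tsum
    (fun i => mul_le_mul_of_nonneg_left (geo_antitone i h) (weight_pos hq i).le)
    (summable_decay hq hd m)

lemma decay_pos (hq : ∀ j, (q j : ℝ) ∈ Set.Ioo (0 : ℝ) 1) (hd : 1 < drift q M) (n : ℕ) :
    0 < decay q M n := by
  refine (summable_decay hq hd n).tsum_pos
    (fun i => mul_nonneg (weight_pos hq i).le (geo_mem_Icc i n).1) 1
    (mul_pos (weight_pos hq 1) ?_)
  simp only [geo]
  positivity

lemma tendsto_decay (hq : ∀ j, (q j : ℝ) ∈ Set.Ioo (0 : ℝ) 1) (hd : 1 < drift q M) :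
    Tendsto (decay q M) atTop (𝓝 0) := by
  have := tendsto_tsum_of_dominated_convergence (𝓕 := atTop)
    (f := fun n i => weight q M i * geo i n) (g := fun i => weight q M i * 0)
    (summable_weight hq hd)
    (fun i => (tendsto_geo i).const_mul _) (Eventually.of_forall fun n i => by
      rw [Real.norm_of_nonneg (mul_nonneg (weight_pos hq i).le (geo_mem_Icc i n).1)]
      exact mul_le_of_le_one_right (weight_pos hq i).le (geo_mem_Icc i n).2)
  simp only [mul_zero, tsum_zero] at this
  exact this

lemma step_decay (hM : 1 ≤ M) (hq : ∀ j, M ≤ j → (q j : ℝ) = 1 / 2)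
    (hq' : ∀ j, (q j : ℝ) ∈ Set.Ioo (0 : ℝ) 1) (hd : 1 < drift q M) {n : ℕ} (hn : M ≤ n) :
    step q (decay q M) n = decay q M n := by
  have hint : ∀ i, Integrable (fun s => weight q M i * geo i (offspring s n)) (stackMeasure q) :=
    fun i => (integrable_offspring (fun m => abs_le_of_mem_Icc (geo_mem_Icc i m)) n).const_mul _
  have hval : ∀ i, ∫ s, weight q M i * geo i (offspring s n) ∂stackMeasure q
      = weight q M (i + 1) * geo (i + 1) n := fun i => by
    rw [integral_const_mul, ← weight_mul_step_geo hq hn, step]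
  have hnorm : ∀ i, ∫ s, ‖weight q M i * geo i (offspring s n)‖ ∂stackMeasure q
      = weight q M (i + 1) * geo (i + 1) n := fun i => by
    rw [← hval i]
    refine integral_congr_ae (ae_of_all _ fun s => ?_)
    exact Real.norm_of_nonneg (mul_nonneg (weight_pos hq' i).le (geo_mem_Icc i _).1)
  have h := integral_tsum_of_summable_integral_norm hint (by
    simp only [hnorm]
    exact (summable_nat_add_iff 1).2 (summable_decay hq' hd n))
  simp only [hval] at h
  rw [step]
  simp only [decay]
  rw [← h, (summable_decay hq' hd n).tsum_eq_zero_add, geo_zero_left (hM.trans hn), mul_zero,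
    zero_add]

lemma one_sub_decay_le_surv (hM : 1 ≤ M) (hq : ∀ j, M ≤ j → (q j : ℝ) = 1 / 2)
    (hq' : ∀ j, (q j : ℝ) ∈ Set.Ioo (0 : ℝ) 1) (hd : 1 < drift q M) (K : ℕ) : ∀ n,
    1 - decay q M n / decay q M (M - 1) ≤ surv q K n := by
  have hpos := decay_pos hq' hd (M - 1)
  have hsmall : ∀ n < M, ∀ K, 1 - decay q M n / decay q M (M - 1) ≤ surv q K n := by
    intro n hn K
    have : 1 ≤ decay q M n / decay q M (M - 1) := by
      rw [one_le_div hpos]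
      exact decay_antitone hq' hd (by omega)
    linarith [(surv_mem_Icc (q := q) K n).1]
  induction K with
  | zero =>
    intro n
    by_cases hn : n < M
    · exact hsmall n hn 0
    · have := div_nonneg (decay_pos hq' hd n).le hpos.le
      rw [surv, if_neg (by omega)]
      linarith
  | succ K ih =>
    intro n
    by_cases hn : n < M
    · exact hsmall n hn _
    have hbd : ∀ m, |decay q M m| ≤ decay q M 0 := fun m => by
      rw [abs_of_pos (decay_pos hq' hd m)]
      exact decay_antitone hq' hd m.zero_le
    have hi : Integrable (fun s => decay q M (offspring s n) / decay q M (M - 1))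
      (stackMeasure q) := (integrable_offspring hbd n).div_const _
    calc 1 - decay q M n / decay q M (M - 1)
        = ∫ s, (1 - decay q M (offspring s n) / decay q M (M - 1)) ∂stackMeasure q := by
          rw [integral_sub (integrable_const _) hi, integral_div,
            ← step_decay hM hq hq' hd (not_lt.1 hn), step]
          simp
      _ ≤ surv q (K + 1) n := integral_mono ((integrable_const _).sub hi)
          (integrable_offspring (fun m => abs_le_of_mem_Icc (surv_mem_Icc K m)) n) fun s => ih _

/-- The branching chain may survive when the total drift is larger than one. -/
lemma survForever_one_pos (hM : 1 ≤ M) (hq : ∀ j, M ≤ j → (q j : ℝ) = 1 / 2)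
    (hq' : ∀ j, (q j : ℝ) ∈ Set.Ioo (0 : ℝ) 1) (hd : 1 < drift q M) :
    0 < survForever q 1 := by
  have hpos := decay_pos hq' hd (M - 1)
  obtain ⟨m, hm⟩ := ((tendsto_decay hq' hd).eventually (eventually_lt_nhds hpos)).exists
  have h1 : 0 < survForever q m := by
    refine lt_of_lt_of_le (sub_pos.2 ((div_lt_one hpos).2 hm))
      (ge_of_tendsto' (tendsto_surv 0 m) fun K => one_sub_decay_le_surv hM hq hq' hd K m)
  have hmeas := measurableSet_offspring_eq 1 m
  calc 0 < (stackMeasure q).real {s | offspring s 1 = m} * survForever q m :=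
        mul_pos (measure_offspring_one_eq_pos hq' m) h1
    _ = ∫ s, {s | offspring s 1 = m}.indicator (fun _ => survForever q m) s ∂stackMeasure q := by
        rw [integral_indicator_const _ hmeas, smul_eq_mul]
    _ ≤ step q (survForever q) 1 := by
        refine integral_mono ((integrable_const _).indicator hmeas) (integrable_offspring
          (fun n => abs_le_of_mem_Icc (survForever_mem_Icc (q := q) n)) 1) fun s => ?_
        simp only [Set.indicator_apply, Set.mem_ofPred_eq]
        split_ifs with h
        · rw [h]
        · exact (survForever_mem_Icc _).1
    _ = survForever q 1 := step_survForever 1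

end Criterion

/-! ### Transience -/

section Transience

variable {M : ℕ}

lemma ae_not_tendsto_atTop (hM : 1 ≤ M) (hq : ∀ j, M ≤ j → (q j : ℝ) = 1 / 2)
    (hq' : ∀ j, (q j : ℝ) ∈ Set.Ioo (0 : ℝ) 1) (hd : drift q M ≤ 1) :
    ∀ᵐ σ ∂envMeasure q, ¬ Tendsto (walk σ) atTop atTop := by
  have h : ∀ᵐ σ ∂envMeasure q, ∀ n, ¬ ∀ K, chain σ 1 n K ≠ 0 := by
    refine ae_all_iff.2 fun n => ?_
    have := measure_forall_chain_ne_zero (q := q) 1 n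
    rw [survForever_eq_zero hM hq hq' hd, measureReal_eq_zero_iff] at this
    exact measure_eq_zero_iff_ae_notMem.1 this
  filter_upwards [h, ae_forall_frequently_eq hq false] with σ h1 h2 h3
  obtain ⟨n, hn⟩ := exists_chain_ne_zero_of_tendsto_atTop h2 h3
  exact h1 n hn

lemma ae_frequently_chain_ne_zero (h : 0 < survForever q 1) :
    ∀ᵐ σ ∂envMeasure q, ∃ᶠ k : ℕ in atTop, ∀ K, chain σ k 1 K ≠ 0 := by
  let S : ℕ → Set (ℤ → ℕ → Bool) := fun k => {σ | ∀ K, chain σ k 1 K ≠ 0}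
  let m : ℕ → MeasurableSpace (ℤ → ℕ → Bool) := fun k =>
    MeasurableSpace.comap (fun σ => σ (k : ℤ)) inferInstance
  have hm : ∀ k, m k ≤ MeasurableSpace.pi := fun k => (measurable_pi_apply (k : ℤ)).comap_le
  have hindep : iIndep m (envMeasure q) :=
    (iIndepFun_env (q := q)).precomp (g := ((↑) : ℕ → ℤ)) Nat.cast_injective
  have hS : ∀ a k, a ≤ k → MeasurableSet[⨆ j ≥ a, m j] (S k) := by
    intro a k hk
    have e : S k = (fun (σ : ℤ → ℕ → Bool) x => σ (max x k)) ⁻¹' {σ | ∀ K, chain σ k 1 K ≠ 0} := by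
      ext σ
      simp only [S, Set.mem_preimage, Set.mem_ofPred_eq]
      refine forall_congr' fun K => ?_
      have hc : chain (fun x => σ (max x k)) k 1 K = chain σ k 1 K :=
        chain_congr K fun x hx => by simp only [max_eq_left hx]
      rw [hc]
    have hmeas : Measurable[⨆ j ≥ a, m j] fun (σ : ℤ → ℕ → Bool) x => σ (max x k) := by
      refine @measurable_pi_lambda _ _ _ (⨆ j ≥ a, m j) _ _ fun x => ?_
      obtain ⟨j, hj⟩ := Int.eq_ofNat_of_zero_le (show 0 ≤ max x (k : ℤ) by omega)
      rw [hj]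
      refine Measurable.mono (comap_measurable (fun σ : ℤ → ℕ → Bool => σ (j : ℤ))) ?_ le_rfl
      exact le_iSup₂_of_le j (by omega) le_rfl
    rw [e]
    refine hmeas ?_
    have : {σ : ℤ → ℕ → Bool | ∀ K, chain σ k 1 K ≠ 0} = ⋂ K, {σ | chain σ k 1 K ≠ 0} := by
      ext; simp
    rw [this]
    exact MeasurableSet.iInter fun K => measurableSet_chain_ne_zero _ _ _
  have htail : MeasurableSet[limsup m atTop] (limsup S atTop) := by
    rw [limsup_eq_iInf_iSup_of_nat (u := m)]
    rw [MeasurableSpace.measurableSet_iInf]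
    intro a
    rw [← limsup_nat_add S a]
    exact @MeasurableSet.measurableSet_limsup _ (⨆ j ≥ a, m j) _ fun k => hS a _ (by omega)
  have hSm : ∀ k, MeasurableSet (S k) := fun k =>
    (iSup₂_le fun j _ => hm j : (⨆ j ≥ k, m j) ≤ MeasurableSpace.pi) _ (hS k k le_rfl)
  have hpos : envMeasure q (limsup S atTop) ≠ 0 := by
    have hle : envMeasure q (S 0) ≤ envMeasure q (limsup S atTop) := by
      rw [limsup_eq_iInf_iSup_of_nat]
      simp only [Set.iInf_eq_iInter, Set.iSup_eq_iUnion]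
      have hanti : Antitone fun a => ⋃ k ≥ a, S k := fun a b hab =>
        Set.biUnion_subset_biUnion_left fun k hk => le_trans hab hk
      refine ge_of_tendsto' (tendsto_measure_iInter_atTop (μ := envMeasure q) (fun a =>
        (MeasurableSet.iUnion fun k => MeasurableSet.iUnion fun _ => hSm k).nullMeasurableSet)
        hanti ⟨0, measure_ne_top _ _⟩) fun a => ?_
      have : envMeasure q (S 0) = envMeasure q (S a) := by
        rw [← ENNReal.toReal_eq_toReal_iff' (measure_ne_top _ _) (measure_ne_top _ _)]
        exact (measure_forall_chain_ne_zero _ 1).trans (measure_forall_chain_ne_zero _ 1).symm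
      rw [this]
      exact measure_mono (Set.subset_biUnion_of_mem (u := S) (Set.mem_Ici.2 le_rfl))
    refine (lt_of_lt_of_le ?_ hle).ne'
    have h0 : (envMeasure q).real (S 0) = survForever q 1 := measure_forall_chain_ne_zero _ 1
    rw [measureReal_def] at h0
    exact (ENNReal.toReal_pos_iff.1 (h0 ▸ h)).1
  have hone := (measure_zero_or_one_of_measurableSet_limsup_atTop hm hindep htail).resolve_left hpos
  filter_upwards [(prob_compl_eq_zero_iff (MeasurableSet.measurableSet_limsup hSm)).2 hone |>
    compl_mem_ae_iff.2] with σ hσ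
  rw [compl_compl] at hσ
  exact (mem_limsup_iff_frequently_mem (s := S)).1 hσ

lemma ae_path_iff {Ω Ω' : Type*} [MeasurableSpace Ω] [MeasurableSpace Ω'] {P : Measure Ω}
    {P' : Measure Ω'} [IsProbabilityMeasure P] [IsProbabilityMeasure P'] {p : Fin M → ℝ} {p₀ : ℝ}
    {X : ℕ → Ω → ℤ} {X' : ℕ → Ω' → ℤ} (hX : IsEARW P M p p₀ X) (hX' : IsEARW P' M p p₀ X')
    {T : (ℕ → ℤ) → Prop} (hT : MeasurableSet {x | T x}) :
    (∀ᵐ ω ∂P, T fun n => X n ω) ↔ ∀ᵐ ω ∂P', T fun n => X' n ω := by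
  rw [← ae_map_iff (measurable_pi_lambda _ hX.measurable).aemeasurable hT,
    ← ae_map_iff (measurable_pi_lambda _ hX'.measurable).aemeasurable hT, map_path_eq hX hX']

lemma cookieSeq_of_le {p : Fin M → ℝ} {p₀ : ℝ} {j : ℕ} (h : M ≤ j) : cookieSeq M p p₀ j = p₀ :=
  dif_neg (not_lt.2 h)

lemma drift_eq {p : Fin M → ℝ} {p₀ : ℝ} (hq : ∀ j, (q j : ℝ) = cookieSeq M p p₀ j) :
    drift q M = ∑ i, (2 * p i - 1) := by
  rw [drift, Finset.sum_range]
  refine Finset.sum_congr rfl fun i _ => ?_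
  rw [hq, cookieSeq, dif_pos i.2]

lemma exists_bias {p : Fin M → ℝ} (hp : ∀ i, p i ∈ Set.Ioo (0 : ℝ) 1) :
    ∃ q : ℕ → unitInterval, (∀ j, (q j : ℝ) = cookieSeq M p (1 / 2) j)
      ∧ (∀ j, M ≤ j → (q j : ℝ) = 1 / 2) ∧ ∀ j, (q j : ℝ) ∈ Set.Ioo (0 : ℝ) 1 := by
  have h := cookieSeq_mem_Ioo hp (p₀ := 1 / 2) (by norm_num)
  exact ⟨fun j => ⟨cookieSeq M p (1 / 2) j, Set.Ioo_subset_Icc_self (h j)⟩, fun _ => rfl,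
    fun j hj => cookieSeq_of_le hj, h⟩

variable {Ω : Type*} [MeasurableSpace Ω] {P : Measure Ω} [IsProbabilityMeasure P]
  {p : Fin M → ℝ} {Y : ℕ → Ω → ℤ}

lemma ae_not_tendsto_atTop_of_sum_le_one (hM : 1 ≤ M) (hp : ∀ i, p i ∈ Set.Ioo (0 : ℝ) 1)
    (hY : IsEARW P M p (1 / 2) Y) (hd : ∑ i, (2 * p i - 1) ≤ 1) :
    ∀ᵐ ω ∂P, ¬ Tendsto (fun n => Y n ω) atTop atTop := by
  obtain ⟨q, hq, hq₁, hq₂⟩ := exists_bias hp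
  rw [ae_path_iff (T := fun x => ¬ Tendsto x atTop atTop) hY (isEARW_walk hq)
    measurableSet_tendsto_atTop.compl]
  exact ae_not_tendsto_atTop hM hq₁ hq₂ ((drift_eq hq).trans_le hd)

lemma ae_tendsto_atTop_of_one_lt_sum (hM : 1 ≤ M) (hp : ∀ i, p i ∈ Set.Ioo (0 : ℝ) 1)
    (hY : IsEARW P M p (1 / 2) Y) (hd : 1 < ∑ i, (2 * p i - 1)) :
    ∀ᵐ ω ∂P, Tendsto (fun n => Y n ω) atTop atTop := by
  obtain ⟨q, hq, hq₁, hq₂⟩ := exists_bias hp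
  have hwalk := isEARW_walk hq
  rw [ae_path_iff (T := fun x => Tendsto x atTop atTop) hY hwalk measurableSet_tendsto_atTop]
  have hneg := isEARW_neg hp (by norm_num) hwalk
  rw [show (1 : ℝ) - 1 / 2 = 1 / 2 by norm_num] at hneg
  have hbot := ae_not_tendsto_atTop_of_sum_le_one hM
    (fun i => ⟨by linarith [(hp i).2], by linarith [(hp i).1]⟩) hneg (by
      have : ∑ i, (2 * (1 - p i) - 1) = -∑ i, (2 * p i - 1) := by
        rw [← Finset.sum_neg_distrib]
        exact Finset.sum_congr rfl fun i _ => by ring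
      linarith)
  filter_upwards [hbot, ae_forall_frequently_eq hq₁ true, ae_frequently_chain_ne_zero
    (survForever_one_pos hM hq₁ hq₂ (hd.trans_eq (drift_eq hq).symm))] with σ h₁ h₂ h₃
  exact tendsto_atTop_of_frequently_chain h₂ (fun h => h₁ (tendsto_neg_atBot_atTop.comp h)) h₃

end Transience

end ExcitedWalk

/-- **Transience criterion for excited random walks.**
A standard excited random walk (`p₀ = 1/2`) with `M` cookies and cookie vector `p` is
transient to the right (i.e. `Y n → +∞` a.s.) iff `δ(M,p) = ∑ i, (2 p i - 1) > 1`. -/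
theorem excited_rw_transient_iff_delta_gt_one
    {Ω : Type*} [MeasurableSpace Ω] (P : Measure Ω) [IsProbabilityMeasure P]
    (M : ℕ) (hM : 1 ≤ M) (p : Fin M → ℝ) (hp : ∀ i, p i ∈ Set.Ioo (0 : ℝ) 1)
    (Y : ℕ → Ω → ℤ) (hY : IsEARW P M p (1 / 2) Y) :
    (∀ᵐ ω ∂P, Tendsto (fun n => Y n ω) atTop atTop)
      ↔ 1 < ∑ i, (2 * p i - 1) := by
  refine ⟨fun h => ?_, ExcitedWalk.ae_tendsto_atTop_of_one_lt_sum hM hp hY⟩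
  by_contra hd
  obtain ⟨ω, h₁, h₂⟩ :=
    (h.and (ExcitedWalk.ae_not_tendsto_atTop_of_sum_le_one hM hp hY (not_lt.1 hd))).exists
  exact h₂ h₁
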